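/- arXiv:1901.06137 — 2 statements merged into one kernel-verified Lean document; each statement's English description precedes it below -/
import Mathlib

section
/- For any positive integers m, n, t with n ≥ m ≥ t ≥ m/2 + 1, the bipartite Turán number of the even cycle satisfies ex(m,n,C_{2t}) = (t−1)n + m − t + 1. -/
section Lists

variable {V : Type*} {r : V → V → Prop}

/-- `l` lists the vertices of a closed walk without repeated vertices. -/
structure IsClosedChain (r : V → V → Prop) (l : List V) : Prop where
  chain : l.IsChain r
  nodup : l.Nodup
  closing : ∀ x ∈ l.getLast?, ∀ y ∈ l.head?, r x y

theorem isClosedChain_append_reverse (hr : ∀ x y, r x y → r y x) {p q : List V}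
    (hc : (p ++ q).IsChain r) (hn : (p ++ q).Nodup) (hp : p ≠ []) (hq : q ≠ [])
    (h₁ : ∀ x ∈ p.getLast?, ∀ y ∈ q.getLast?, r x y)
    (h₂ : ∀ x ∈ q.head?, ∀ y ∈ p.head?, r x y) :
    IsClosedChain r (p ++ q.reverse) := by
  rw [List.isChain_append] at hc
  refine ⟨?_, ?_, ?_⟩
  · rw [List.isChain_append, List.isChain_reverse]
    refine ⟨hc.1, ?_, ?_⟩
    · exact hc.2.1.imp fun x y => hr x y
    · simpa using h₁
  · exact ((List.reverse_perm q).append_left p).nodup_iff.2 hn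
  · rw [List.getLast?_append_of_ne_nil _ (by simpa), List.head?_append_of_ne_nil _ hp,
      List.getLast?_reverse]
    exact h₂

theorem nodup_reverse_append_cons {p q : List V} {u v : V}
    (hn : (p ++ v :: q).Nodup) (hu : u ∉ p ++ v :: q) :
    (p.reverse ++ u :: q).Nodup ∧ v ∉ p.reverse ++ u :: q := by
  simp only [List.nodup_append', List.nodup_cons, List.nodup_reverse] at hn ⊢
  simp only [List.mem_append, List.mem_cons, List.mem_reverse,
    List.disjoint_left] at *
  grind

theorem isClosedChain_cons_append_reverse (hr : ∀ x y, r x y → r y x) {p q : List V} {u v : V}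
    (hc : (p ++ v :: q).IsChain r) (hn : (p ++ v :: q).Nodup) (hu : u ∉ p ++ v :: q)
    (hp : p ≠ []) (hq : q ≠ [])
    (h₁ : ∀ x ∈ p.getLast?, ∀ y ∈ q.getLast?, r x y)
    (h₂ : ∀ x ∈ q.head?, r u x) (h₃ : ∀ x ∈ p.head?, r u x) :
    IsClosedChain r (u :: (q ++ p.reverse)) := by
  rw [List.isChain_append] at hc
  refine ⟨?_, ?_, ?_⟩
  · rw [List.isChain_cons, List.isChain_append, List.isChain_reverse,
      List.head?_append_of_ne_nil _ hq]
    refine ⟨h₂, hc.2.1.tail, hc.1.imp fun x y => hr x y, ?_⟩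
    intro x hx y hy
    rw [List.head?_reverse] at hy
    exact hr _ _ (h₁ _ hy _ hx)
  · have := (nodup_reverse_append_cons hn hu).1
    exact ((List.perm_append_comm (l₁ := p.reverse) (l₂ := u :: q)).nodup_iff).1 this
  · rw [← List.cons_append, List.getLast?_append_of_ne_nil _ (by simpa), List.getLast?_reverse]
    simpa using fun x hx => hr _ _ (h₃ x hx)

theorem isChain_reverse_append_cons (hr : ∀ x y, r x y → r y x) {p q : List V} {u v : V}
    (hc : (p ++ v :: q).IsChain r)
    (h₂ : ∀ x ∈ q.head?, r u x) (h₃ : ∀ x ∈ p.head?, r u x) :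
    (p.reverse ++ u :: q).IsChain r := by
  rw [List.isChain_append] at hc ⊢
  refine ⟨List.isChain_reverse.2 (hc.1.imp fun x y => hr x y), ?_, ?_⟩
  · rw [List.isChain_cons]; exact ⟨h₂, hc.2.1.tail⟩
  · simpa using fun x hx => hr _ _ (h₃ x hx)

end Lists

section Sum

variable {α β : Type*} {E : α → β → Prop}

/-- The symmetric relation on `α ⊕ β` induced by a relation between `α` and `β`. -/
def SumAdj (E : α → β → Prop) : α ⊕ β → α ⊕ β → Prop
  | .inl a, .inr b => E a b
  | .inr b, .inl a => E a b
  | _, _ => False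

@[simp] theorem sumAdj_inl_inr {a : α} {b : β} : SumAdj E (.inl a) (.inr b) ↔ E a b := Iff.rfl

@[simp] theorem sumAdj_inr_inl {a : α} {b : β} : SumAdj E (.inr b) (.inl a) ↔ E a b := Iff.rfl

@[simp] theorem not_sumAdj_inl {a a' : α} : ¬ SumAdj E (.inl a) (.inl a') := id

@[simp] theorem not_sumAdj_inr {b b' : β} : ¬ SumAdj E (.inr b) (.inr b') := id

theorem sumAdj_symm : ∀ x y, SumAdj E x y → SumAdj E y x
  | .inl _, .inr _, h => h
  | .inr _, .inl _, h => h

/-- `l` is the vertex list `a 0, b 0, a 1, b 1, …, a (t - 1), b (t - 1)` of a path. -/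
structure IsAltPath (E : α → β → Prop) (t : ℕ) (a : ℕ → α) (b : ℕ → β) (l : List (α ⊕ β)) :
    Prop where
  chain : l.IsChain (SumAdj E)
  nodup : l.Nodup
  length_eq : l.length = 2 * t
  left : ∀ i < t, l[2 * i]? = some (.inl (a i))
  right : ∀ i < t, l[2 * i + 1]? = some (.inr (b i))

theorem exists_isAltPath {t : ℕ} {l : List (α ⊕ β)} {y : α} {z : β}
    (hc : l.IsChain (SumAdj E)) (hn : l.Nodup) (hl : l.length = 2 * t)
    (hy : l.head? = some (.inl y)) (hz : l.getLast? = some (.inr z)) :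
    ∃ a b, IsAltPath E t a b l ∧ a 0 = y ∧ b (t - 1) = z := by
  have key : ∀ i, i < t → ∃ a b, l[2 * i]? = some (.inl a) ∧ l[2 * i + 1]? = some (.inr b) := by
    have step : ∀ i (h : i + 1 < l.length), SumAdj E l[i] l[i + 1] := List.isChain_iff_getElem.1 hc
    intro i
    induction i with
    | zero =>
      intro hi
      have h1 := step 0 (by omega)
      have h0 : l[0] = .inl y := by
        rw [List.head?_eq_getElem?, List.getElem?_eq_some_iff] at hy
        exact hy.2
      rw [h0] at h1
      rcases h2 : l[0 + 1]'(by omega) with a | b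
      · rw [h2] at h1; exact h1.elim
      · exact ⟨y, b, by simpa [List.getElem?_eq_some_iff] using ⟨by omega, h0⟩,
          List.getElem?_eq_some_iff.2 ⟨by omega, h2⟩⟩
    | succ i ih =>
      intro hi
      obtain ⟨a, b, -, hb⟩ := ih (by omega)
      obtain ⟨hb1, hb⟩ := List.getElem?_eq_some_iff.1 hb
      have h1 := step (2 * i + 1) (by omega)
      have h2 := step (2 * i + 2) (by omega)
      rw [hb] at h1
      rcases h3 : l[2 * i + 1 + 1]'(by omega) with a' | b'
      · rw [h3] at h2
        rcases h4 : l[2 * i + 2 + 1]'(by omega) with a'' | b''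
        · rw [h4] at h2; exact h2.elim
        · exact ⟨a', b'', List.getElem?_eq_some_iff.2 ⟨by omega, h3⟩,
            List.getElem?_eq_some_iff.2 ⟨by omega, h4⟩⟩
      · rw [h3] at h1; exact h1.elim
  have : Nonempty α := ⟨y⟩
  have : Nonempty β := ⟨z⟩
  choose! a b ha hb using key
  have ht : 0 < t := by
    by_contra h
    have : l = [] := List.length_eq_zero_iff.1 (by omega)
    simp [this] at hy
  refine ⟨a, b, ⟨hc, hn, hl, ha, hb⟩, ?_, ?_⟩
  · have := ha 0 ht
    rw [List.head?_eq_getElem?] at hy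
    simpa [hy, eq_comm] using this
  · have := hb (t - 1) (by omega)
    rw [List.getLast?_eq_getElem?, hl, show 2 * t - 1 = 2 * (t - 1) + 1 by omega] at hz
    simpa [hz, eq_comm] using this

namespace IsAltPath

variable {t : ℕ} {a : ℕ → α} {b : ℕ → β} {l : List (α ⊕ β)}

theorem adj_right (h : IsAltPath E t a b l) {i : ℕ} (hi : i < t) : E (a i) (b i) := by
  have := List.isChain_iff_getElem.1 h.chain (2 * i) (by have := h.length_eq; omega)
  rwa [(List.getElem?_eq_some_iff.1 (h.left i hi)).2,
    (List.getElem?_eq_some_iff.1 (h.right i hi)).2] at this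

theorem adj_left (h : IsAltPath E t a b l) {i : ℕ} (hi : i + 1 < t) : E (a (i + 1)) (b i) := by
  have := List.isChain_iff_getElem.1 h.chain (2 * i + 1) (by have := h.length_eq; omega)
  have h2 := (List.getElem?_eq_some_iff.1 (h.left (i + 1) hi)).2
  simp only [(List.getElem?_eq_some_iff.1 (h.right i (by omega))).2] at this
  simp only [show 2 * (i + 1) = 2 * i + 1 + 1 by ring] at h2
  rw [h2] at this
  exact this

theorem injOn_left (h : IsAltPath E t a b l) : Set.InjOn a (Set.Iio t) := by
  intro i hi j hj hij
  have h1 := h.left i hi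
  have h2 := h.left j hj
  rw [← hij, ← h1] at h2
  have := (List.getElem?_inj (by have := h.length_eq; have : i < t := hi; omega) h.nodup).1 h2.symm
  omega

theorem injOn_right (h : IsAltPath E t a b l) : Set.InjOn b (Set.Iio t) := by
  intro i hi j hj hij
  have h1 := h.right i hi
  have h2 := h.right j hj
  rw [← hij, ← h1] at h2
  have := (List.getElem?_inj (by have := h.length_eq; have : i < t := hi; omega) h.nodup).1 h2.symm
  omega

theorem exists_left_eq [Fintype α] (h : IsAltPath E t a b l) (hα : Fintype.card α = t) (x : α) :
    ∃ i < t, a i = x := by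
  classical
  have : (Finset.range t).image a = Finset.univ := by
    apply Finset.eq_univ_of_card
    rw [Finset.card_image_of_injOn (by simpa using h.injOn_left), Finset.card_range, hα]
  have hx := Finset.mem_univ x
  rw [← this] at hx
  simpa using hx

theorem mem_iff (h : IsAltPath E t a b l) {x : β} : Sum.inr x ∈ l ↔ ∃ i < t, b i = x := by
  constructor
  · intro hx
    obtain ⟨k, hk, hkx⟩ := List.getElem_of_mem hx
    have hk' := h.length_eq ▸ hk
    rcases Nat.even_or_odd' k with ⟨i, rfl | rfl⟩
    · have := h.left i (by omega)
      rw [List.getElem?_eq_getElem hk, hkx] at this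
      simp at this
    · have := h.right i (by omega)
      rw [List.getElem?_eq_getElem hk, hkx] at this
      exact ⟨i, by omega, by simpa [eq_comm] using this⟩
  · rintro ⟨i, hi, rfl⟩
    exact List.mem_of_getElem? (h.right i hi)

theorem right_mem (h : IsAltPath E t a b l) {i : ℕ} (hi : i < t) : Sum.inr (b i) ∈ l :=
  h.mem_iff.2 ⟨i, hi, rfl⟩

theorem head? (h : IsAltPath E t a b l) (ht : 0 < t) : l.head? = some (.inl (a 0)) := by
  rw [List.head?_eq_getElem?]; exact h.left 0 ht

theorem getLast? (h : IsAltPath E t a b l) (ht : 0 < t) :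
    l.getLast? = some (.inr (b (t - 1))) := by
  rw [List.getLast?_eq_getElem?, h.length_eq, show 2 * t - 1 = 2 * (t - 1) + 1 by omega]
  exact h.right _ (by omega)

/-- Splitting an alternating path after `a i`. -/
theorem exists_split (h : IsAltPath E t a b l) {i : ℕ} (hi : i < t) :
    ∃ p q, l = p ++ q ∧ p.length = 2 * i + 1 ∧ p.head? = some (.inl (a 0)) ∧
      p.getLast? = some (.inl (a i)) ∧ q.head? = some (.inr (b i)) ∧
      q.getLast? = some (.inr (b (t - 1))) := by
  have hl := h.length_eq
  refine ⟨l.take (2 * i + 1), l.drop (2 * i + 1), (List.take_append_drop _ _).symm, ?_, ?_, ?_, ?_,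
    ?_⟩
  · simp; omega
  · rw [List.head?_take, h.head? (by omega)]; simp
  · rw [List.getLast?_take, show 2 * i + 1 - 1 = 2 * i by omega, h.left i hi]; simp
  · rw [List.head?_drop, h.right i hi]
  · rw [List.getLast?_drop, if_neg (by omega), h.getLast? (by omega)]

/-- Splitting an alternating path around `b i`. -/
theorem exists_split_around (h : IsAltPath E t a b l) {i : ℕ} (hi : i + 1 < t) :
    ∃ p q, l = p ++ .inr (b i) :: q ∧ p.head? = some (.inl (a 0)) ∧
      p.getLast? = some (.inl (a i)) ∧ q.head? = some (.inl (a (i + 1))) ∧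
      q.getLast? = some (.inr (b (t - 1))) := by
  obtain ⟨p, q, rfl, hpl, hp₁, hp₂, hq₁, hq₂⟩ := h.exists_split (i := i) (by omega)
  cases q with
  | nil => simp at hq₁
  | cons x q =>
    obtain rfl : x = .inr (b i) := by simpa using hq₁
    have h1 := h.left (i + 1) hi
    rw [List.getElem?_append_right (by omega), hpl,
      show 2 * (i + 1) - (2 * i + 1) = 0 + 1 by omega, List.getElem?_cons_succ,
      ← List.head?_eq_getElem?] at h1
    refine ⟨p, q, rfl, hp₁, hp₂, h1, ?_⟩
    rw [List.getLast?_cons] at hq₂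
    cases q with
    | nil => simp at h1
    | cons x q => simpa [List.getLast?_cons] using hq₂

theorem exists_closed_of_cross (h : IsAltPath E t a b l) {i : ℕ} (hi : i < t)
    (h₁ : E (a i) (b (t - 1))) (h₂ : E (a 0) (b i)) :
    ∃ l', IsClosedChain (SumAdj E) l' ∧ l'.length = 2 * t := by
  obtain ⟨p, q, rfl, hpl, hp₁, hp₂, hq₁, hq₂⟩ := h.exists_split hi
  refine ⟨p ++ q.reverse, isClosedChain_append_reverse sumAdj_symm h.chain h.nodup ?_ ?_ ?_ ?_, ?_⟩
  · rintro rfl; simp at hp₁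
  · rintro rfl; simp at hq₁
  · simpa [hp₂, hq₂] using h₁
  · simpa [hp₁, hq₁] using h₂
  · simpa using h.length_eq

theorem exists_closed_of_skip (h : IsAltPath E t a b l) {i : ℕ} (hi : i + 1 < t) {u : β}
    (hu : Sum.inr u ∉ l) (h₁ : E (a i) (b (t - 1))) (h₂ : E (a 0) u) (h₃ : E (a (i + 1)) u) :
    ∃ l', IsClosedChain (SumAdj E) l' ∧ l'.length = 2 * t := by
  obtain ⟨p, q, rfl, hp₁, hp₂, hq₁, hq₂⟩ := h.exists_split_around hi
  refine ⟨_, isClosedChain_cons_append_reverse sumAdj_symm h.chain h.nodup hu ?_ ?_ ?_ ?_ ?_, ?_⟩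
  · rintro rfl; simp at hp₁
  · rintro rfl; simp at hq₁
  · simpa [hp₂, hq₂] using h₁
  · simpa [hq₁] using h₃
  · simpa [hp₁] using h₂
  · have := h.length_eq
    simp at this ⊢
    omega

theorem exists_reroute (h : IsAltPath E t a b l) {i : ℕ} (hi : i + 1 < t) {u : β}
    (hu : Sum.inr u ∉ l) (h₂ : E (a 0) u) (h₃ : E (a (i + 1)) u) :
    ∃ a' b' l', IsAltPath E t a' b' l' ∧ a' 0 = a i ∧ b' (t - 1) = b (t - 1) ∧
      Sum.inr (b i) ∉ l' := by
  have hl := h.length_eq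
  obtain ⟨p, q, rfl, hp₁, hp₂, hq₁, hq₂⟩ := h.exists_split_around hi
  have hn := nodup_reverse_append_cons h.nodup hu
  have hp : p ≠ [] := by rintro rfl; simp at hp₁
  have hq : q ≠ [] := by rintro rfl; simp at hq₁
  obtain ⟨a', b', h', h1, h2⟩ := exists_isAltPath (t := t) (y := a i) (z := b (t - 1))
    (isChain_reverse_append_cons (u := Sum.inr u) sumAdj_symm h.chain (by simpa [hq₁] using h₃)
      (by simpa [hp₁] using h₂)) hn.1 (by simp at hl ⊢; omega)
      (by rw [List.head?_append_of_ne_nil _ (by simpa), List.head?_reverse, hp₂])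
      (by rw [List.append_cons, List.getLast?_append_of_ne_nil _ hq, hq₂])
  exact ⟨a', b', _, h', h1, h2, hn.2⟩

end IsAltPath

end Sum
theorem missing_arith {c ρ s r q k h : ℤ} (hρ : 1 ≤ ρ) (hρc : ρ ≤ c) (hs : 1 ≤ s)
    (hr : 0 ≤ r) (hk : 0 ≤ k) (hks : k ≤ s) (hkq : k ≤ q) (hqc : q ≤ c) (hhc : h ≤ c)
    (hd : s + r ≤ c) (hh : s + q ≤ h + k) :
    c - 1 + (ρ - 1) * (s + r) < (c + ρ - (s + r)) * h + r * (c - q) + k * (c - h) := by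
  have hrq : 0 ≤ r * (c - q) := mul_nonneg hr (by linarith)
  have hkh : 0 ≤ k * (c - h) := mul_nonneg hk (by linarith)
  rcases le_or_gt h (s + r) with hle | hgt
  · obtain ⟨e, rfl⟩ : ∃ e, s = e + k := ⟨s - k, by ring⟩
    have h1 : 0 ≤ (c - ρ) * (e + k + r - h) := mul_nonneg (by linarith) (by linarith)
    have h2 : 0 ≤ (2 * c - (e + k + r) - k) * (h - (e + q)) :=
      mul_nonneg (by linarith) (by linarith)
    have he : 0 ≤ e := by linarith
    have h3 : 0 ≤ (c - r - (e + k)) * (e + 2 * q - 1) := mul_nonneg (by linarith) (by linarith)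
    have h4 : 0 ≤ e * (q - k) := mul_nonneg he (by linarith)
    have h5 : 0 ≤ k * (q - k) := mul_nonneg hk (by linarith)
    nlinarith
  · have h1 : 0 ≤ (ρ - 1) * (h - (s + r)) := mul_nonneg (by linarith) (by linarith)
    have h2 : 0 ≤ (s + r) * (c - (s + r)) := mul_nonneg (by linarith) (by linarith)
    have h3 : 0 ≤ (c + 1 - (s + r)) * (h - (s + r + 1)) := mul_nonneg (by linarith) (by linarith)
    nlinarith

section Counting

open Finset
open scoped Classical in
/-- The number of elements of `α` not related to `x`. -/
noncomputable def missing {α β : Type*} [Fintype α] (E : α → β → Prop) (x : β) : ℕ :=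
  #{a | ¬ E a x}

open scoped Classical in
/-- The number of elements of `β` related to `a`. -/
noncomputable def leftDegree {α β : Type*} [Fintype β] (E : α → β → Prop) (a : α) : ℕ :=
  #{b | E a b}

variable {α β : Type*} [Fintype α] {E : α → β → Prop}
variable {t : ℕ} {a : ℕ → α} {b : ℕ → β} {l : List (α ⊕ β)}

namespace IsAltPath

theorem le_missing_add (h : IsAltPath E t a b l) (hα : Fintype.card α = t) {u : β} {J : Finset ℕ}
    (hJ : ∀ j, j + 1 < t → E (a (j + 1)) u → j ∈ J) :
    t ≤ missing E u + 1 + #J := by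
  classical
  have h1 : ({x | E x u} : Finset α) ⊆ insert (a 0) (J.image fun j => a (j + 1)) := by
    intro x hx
    obtain ⟨i, hi, rfl⟩ := h.exists_left_eq hα x
    rcases i with _ | i
    · simp
    · exact mem_insert_of_mem (mem_image_of_mem (fun j => a (j + 1)) (hJ i hi (by simpa using hx)))
  have h2 := (card_le_card h1).trans (card_insert_le _ _)
  have h3 : #(J.image fun j => a (j + 1)) ≤ #J := card_image_le
  have h4 : #{x | E x u} + missing E u = Fintype.card α :=
    card_filter_add_card_filter_not (s := univ) (fun x => E x u)
  omega

theorem card_le_missing (h : IsAltPath E t a b l) {S : Finset ℕ}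
    (hS : ∀ i ∈ S, i < t ∧ ¬ E (a i) (b (t - 1))) : #S ≤ missing E (b (t - 1)) := by
  classical
  rw [← card_image_of_injOn (s := S) (f := a)
    (h.injOn_left.mono fun i hi => (hS i hi).1)]
  refine card_le_card fun x hx => ?_
  obtain ⟨i, hi, rfl⟩ := mem_image.1 hx
  simpa using (hS i hi).2

theorem le_missing_add_missing (hno : ¬ ∃ l', IsClosedChain (SumAdj E) l' ∧ l'.length = 2 * t)
    (h : IsAltPath E t a b l) (hα : Fintype.card α = t) {u : β}
    (hu : Sum.inr u ∉ l) (hE : E (a 0) u) : t ≤ missing E u + 1 + missing E (b (t - 1)) := by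
  classical
  refine (h.le_missing_add hα (u := u) (J := {j ∈ range (t - 1) | E (a (j + 1)) u}) ?_).trans ?_
  · intro j hj hj'
    simpa using ⟨by omega, hj'⟩
  · gcongr
    refine h.card_le_missing fun j hj => ?_
    simp only [mem_filter, mem_range] at hj
    exact ⟨by omega, fun hz => hno (h.exists_closed_of_skip (by omega) hu hz hE hj.2)⟩

theorem lt_sum_missing [Fintype β] (hno : ¬ ∃ l', IsClosedChain (SumAdj E) l' ∧ l'.length = 2 * t)
    (h : IsAltPath E t a b l) (hα : Fintype.card α = t)
    (ht : 2 ≤ t) (htm : t ≤ Fintype.card β) (hmt : Fintype.card β + 2 ≤ 2 * t)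
    (hz : ¬ E (a 0) (b (t - 1)))
    (hmax : ∀ x, ¬ E (a 0) x → missing E (b (t - 1)) ≤ missing E x)
    (hd : leftDegree E (a 0) < t) :
    t - 2 + (Fintype.card β - t) * leftDegree E (a 0) < ∑ x, missing E x := by
  classical
  set H := missing E (b (t - 1)) with hH
  set U : Finset β := {u | E (a 0) u ∧ Sum.inr u ∉ l} with hU
  set K := {k ∈ range (t - 1) | E (a 0) (b k)} with hK
  set J := {j ∈ range (t - 1) | ∃ u ∈ U, E (a (j + 1)) u} with hJ
  set N : Finset β := {x | ¬ E (a 0) x} with hN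
  have hKJ : #(K ∪ J) ≤ H := by
    refine h.card_le_missing fun i hi => ?_
    rcases mem_union.1 hi with hi | hi
    · simp only [hK, mem_filter, mem_range] at hi
      exact ⟨by omega, fun hz => hno (h.exists_closed_of_cross (by omega) hz hi.2)⟩
    · simp only [hJ, hU, mem_filter, mem_range, mem_univ, true_and] at hi
      obtain ⟨hi, u, hu, hiu⟩ := hi
      exact ⟨by omega, fun hz => hno (h.exists_closed_of_skip (by omega) hu.2 hz hu.1 hiu)⟩
  have hHt : H ≤ t - 1 := by
    have : H < Fintype.card α := by
      refine card_lt_univ_of_notMem (x := a (t - 1)) ?_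
      simpa using h.adj_right (i := t - 1) (by omega)
    omega
  have hUm : ∀ u ∈ U, t - 1 - #J ≤ missing E u := by
    intro u hu
    have := h.le_missing_add hα (u := u) (J := J) fun j hj hj' => by
      simpa [hJ] using ⟨by omega, u, hu, hj'⟩
    omega
  have hKm : ∀ k ∈ K ∩ J, t - 1 - H ≤ missing E (b k) := by
    intro k hk
    simp only [hK, hJ, hU, mem_inter, mem_filter, mem_range, mem_univ, true_and] at hk
    obtain ⟨⟨hkt, hk0⟩, -, u, hu, hku⟩ := hk
    obtain ⟨a', b', l', h', ha', hb', hl'⟩ := h.exists_reroute (i := k) (by omega) hu.2 hu.1 hku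
    have := h'.le_missing_add_missing hno hα hl' (by rw [ha']; exact h.adj_right (by omega))
    rw [hb', ← hH] at this
    omega
  have hinj : Set.InjOn b K := h.injOn_right.mono fun i hi => by
    have := mem_range.1 (mem_filter.1 (mem_coe.1 hi)).1
    exact Set.mem_Iio.2 (by omega)
  have hdisj : Disjoint U (K.image b) := by
    rw [disjoint_left]
    intro x hx hx'
    obtain ⟨i, hi, rfl⟩ := mem_image.1 hx'
    simp only [hK, mem_filter, mem_range] at hi
    exact (mem_filter.1 hx).2.2 (h.right_mem (by omega))
  have hunion : ({x | E (a 0) x} : Finset β) = U ∪ K.image b := by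
    ext x
    simp only [hU, hK, mem_filter, mem_univ, true_and, mem_union, mem_image, mem_range]
    constructor
    · intro hx
      by_cases hxl : Sum.inr x ∈ l
      · obtain ⟨i, hi, rfl⟩ := h.mem_iff.1 hxl
        refine .inr ⟨i, ⟨?_, hx⟩, rfl⟩
        have : i ≠ t - 1 := by rintro rfl; exact hz hx
        omega
      · exact .inl ⟨hx, hxl⟩
    · rintro (hx | ⟨i, hi, rfl⟩)
      exacts [hx.1, hi.2]
  have hdeg : leftDegree E (a 0) = #U + #K := by
    rw [leftDegree]
    rw [hunion, card_union_of_disjoint hdisj, card_image_of_injOn hinj]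
  have hNc : leftDegree E (a 0) + #N = Fintype.card β :=
    card_filter_add_card_filter_not (s := univ) (fun x => E (a 0) x)
  have hsum : #N * H + (#U * (t - 1 - #J) + #(K ∩ J) * (t - 1 - H)) ≤ ∑ x, missing E x := by
    rw [← sum_filter_add_sum_filter_not univ (fun x => E (a 0) x), hunion, sum_union hdisj,
      add_comm]
    refine add_le_add (add_le_add ?_ ?_) ?_
    · rw [← smul_eq_mul]; exact card_nsmul_le_sum _ _ _ hUm
    · rw [sum_image hinj]
      refine le_trans ?_ (sum_le_sum_of_subset (inter_subset_left (s₁ := K) (s₂ := J)))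
      rw [← smul_eq_mul]; exact card_nsmul_le_sum _ _ _ hKm
    · rw [← smul_eq_mul]; exact card_nsmul_le_sum _ _ _ fun x hx => hmax x (mem_filter.1 hx).2
  have hK1 : 1 ≤ #K := card_pos.2 ⟨0, by
    simpa [hK] using ⟨by omega, h.adj_right (i := 0) (by omega)⟩⟩
  have hJc : #J ≤ t - 1 := (card_filter_le _ _).trans (by simp)
  have hKJ' := card_union_add_card_inter K J
  have hi1 := card_le_card (inter_subset_left (s₁ := K) (s₂ := J))
  have hi2 := card_le_card (inter_subset_right (s₁ := K) (s₂ := J))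
  refine lt_of_lt_of_le ?_ hsum
  have := missing_arith (c := t - 1) (ρ := Fintype.card β - (t - 1)) (s := #K) (r := #U) (q := #J)
    (k := #(K ∩ J)) (h := H) (by omega) (by omega) (by omega) (by omega) (by omega) (by omega)
    (by omega) (by omega) (by omega) (by omega) (by omega)
  zify [ht, htm, hHt, hJc, show 1 ≤ t by omega] at *
  have e1 : (#N : ℤ) = t - 1 + (Fintype.card β - (t - 1)) - (#K + #U) := by linarith
  rw [e1, hdeg]
  linarith

end IsAltPath
end Counting

section Lists

variable {V : Type*} {r : V → V → Prop}

theorem isClosedChain_cons (hr : ∀ x y, r x y → r y x) {p : List V} {u : V} (hc : p.IsChain r)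
    (hn : p.Nodup) (hu : u ∉ p) (hp : p ≠ []) (h₁ : ∀ x ∈ p.head?, r u x)
    (h₂ : ∀ x ∈ p.getLast?, r u x) : IsClosedChain r (u :: p) := by
  refine ⟨List.isChain_cons.2 ⟨h₁, hc⟩, List.nodup_cons.2 ⟨hu, hn⟩, ?_⟩
  rw [← List.singleton_append, List.getLast?_append_of_ne_nil _ hp]
  simpa using fun x hx => hr _ _ (h₂ x hx)

theorem isChain_append_append_singleton {x : V} {p q : List V}
    (hc : (x :: (p ++ q)).IsChain r) (hp : p ≠ [])
    (h₁ : ∀ y ∈ q.getLast?, ∀ z ∈ p.head?, r y z) (h₂ : ∀ y ∈ p.getLast?, r y x) :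
    (q ++ (p ++ [x])).IsChain r := by
  have hc := List.isChain_append.1 hc.tail
  rw [List.isChain_append, List.isChain_append, List.head?_append_of_ne_nil _ hp]
  exact ⟨hc.2.1, ⟨hc.1, List.isChain_singleton x, by simpa using h₂⟩, h₁⟩

theorem isChain_append_cons_reverse (hr : ∀ x y, r x y → r y x) {x : V} {p q s : List V}
    (hc : (x :: (p ++ (q ++ s))).IsChain r) (hp : p ≠ [])
    (h₁ : ∀ y ∈ s.getLast?, ∀ z ∈ p.head?, r y z) (h₂ : ∀ y ∈ p.getLast?, r x y)
    (h₃ : ∀ y ∈ q.getLast?, r y x) :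
    (q ++ x :: (p.reverse ++ s.reverse)).IsChain r := by
  have hc := List.isChain_append.1 hc.tail
  have hc' := List.isChain_append.1 hc.2.1
  rw [List.isChain_append, List.isChain_cons, List.isChain_append,
    List.head?_append_of_ne_nil _ (by simpa), List.isChain_reverse, List.isChain_reverse]
  refine ⟨hc'.1, ⟨by simpa using h₂, hc.1.imp fun x y => hr x y, hc'.2.1.imp fun x y => hr x y, ?_⟩,
    by simpa using h₃⟩
  simpa using fun y hy z hz => hr _ _ (h₁ z hz y hy)

theorem exists_eq_append_of_le_length {l : List V} {n : ℕ} (h : n ≤ l.length) :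
    ∃ p q, l = p ++ q ∧ p.length = n :=
  ⟨_, _, (List.take_append_drop n l).symm, by simpa using h⟩

end Lists

namespace IsAltPath

open Finset

variable {α β : Type*} {E : α → β → Prop}
variable {t : ℕ} {a : ℕ → α} {b : ℕ → β} {l : List (α ⊕ β)}

theorem exists_closed_of_common (h : IsAltPath E t a b l) (ht : 2 ≤ t) {o : β}
    (ho : ∀ k < t - 1, b k ≠ o) (h₁ : E (a 0) o) (h₂ : E (a (t - 1)) o) :
    ∃ l', IsClosedChain (SumAdj E) l' ∧ l'.length = 2 * t := by
  have hl := h.length_eq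
  obtain ⟨p, q, rfl, hpl, hp₁, hp₂, hq₁, -⟩ := h.exists_split (i := t - 1) (by omega)
  refine ⟨_, isClosedChain_cons (u := Sum.inr o) (p := p) sumAdj_symm ?_ ?_ ?_ ?_ ?_ ?_, ?_⟩
  · exact h.chain.left_of_append
  · exact h.nodup.of_append_left
  · intro hop
    obtain ⟨i, hi, rfl⟩ := h.mem_iff.1 (List.mem_append_left q hop)
    obtain rfl : i = t - 1 := by
      by_contra hne
      exact ho i (by omega) rfl
    exact List.disjoint_of_nodup_append h.nodup hop (List.mem_of_mem_head? hq₁)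
  · rintro rfl; simp at hp₁
  · simpa [hp₁] using h₁
  · simpa [hp₂] using h₂
  · simp; omega

theorem exists_lollipop (h : IsAltPath E t a b l) {k : ℕ} (hk : k + 2 < t)
    (h₁ : E (a 0) (b (k + 1))) (h₂ : E (a (t - 1)) (b k)) {o : β} (ho : ∀ k < t - 1, b k ≠ o)
    (hE : E (a 0) o) :
    ∃ a' b' l', IsAltPath E t a' b' l' ∧ E (a' (t - 1)) (b' 0) := by
  have hl := h.length_eq
  obtain ⟨L, z, rfl, hLl⟩ := exists_eq_append_of_le_length (l := l) (n := 2 * t - 1) (by omega)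
  have hoL : Sum.inr o ∉ L := by
    intro hop
    obtain ⟨i, hi, rfl⟩ := h.mem_iff.1 (List.mem_append_left z hop)
    obtain rfl : i = t - 1 := by
      by_contra hne
      exact ho i (by omega) rfl
    have := h.right (t - 1) (by omega)
    rw [List.getElem?_append_right (by omega)] at this
    exact List.disjoint_of_nodup_append h.nodup hop (List.mem_of_getElem? this)
  have hc := h.chain.left_of_append
  have hn := h.nodup.of_append_left
  have hL₁ : ∀ i < t, L[2 * i]? = some (.inl (a i)) := fun i hi => by
    rw [← h.left i hi, List.getElem?_append_left (by omega)]
  have hL₂ : ∀ i, i + 1 < t → L[2 * i + 1]? = some (.inr (b i)) := fun i hi => by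
    rw [← h.right i (by omega), List.getElem?_append_left (by omega)]
  obtain ⟨p, s, rfl, hpl⟩ := exists_eq_append_of_le_length (l := L) (n := 2 * (k + 1)) (by omega)
  have hsl : s.length = 2 * t - 1 - 2 * (k + 1) := by simp at hLl; omega
  have hs : s ≠ [] := by rintro rfl; simp at hsl; omega
  have hp : p ≠ [] := by rintro rfl; simp at hpl
  have hs₀ : s.head? = some (.inl (a (k + 1))) := by
    rw [List.head?_eq_getElem?, ← hL₁ _ (by omega), List.getElem?_append_right (by omega), hpl]
    simp
  have hs₁ : s[1]? = some (.inr (b (k + 1))) := by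
    rw [← hL₂ _ (by omega), List.getElem?_append_right (by omega), hpl]
    simp
  have hs₂ : s.getLast? = some (.inl (a (t - 1))) := by
    rw [List.getLast?_eq_getElem?, ← hL₁ _ (by omega), List.getElem?_append_right (by omega), hpl,
      hsl]
    congr 1; omega
  have hp₁ : p.head? = some (.inl (a 0)) := by
    rw [List.head?_eq_getElem?, ← hL₁ _ (by omega), List.getElem?_append_left (by omega)]
  have hp₂ : p.getLast? = some (.inr (b k)) := by
    rw [List.getLast?_eq_getElem?, ← hL₂ _ (by omega), List.getElem?_append_left (by omega), hpl]
    congr 1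
  have hc' := List.isChain_append.1 hc
  have hchain : (s ++ (p.reverse ++ [Sum.inr o])).IsChain (SumAdj E) := by
    rw [List.isChain_append, List.isChain_append, List.isChain_reverse,
      List.head?_append_of_ne_nil _ (by simpa)]
    refine ⟨hc'.2.1, ⟨hc'.1.imp fun x y => sumAdj_symm x y, List.isChain_singleton _, ?_⟩, ?_⟩
    · simpa [hp₁] using hE
    · simpa [hs₂, hp₂] using h₂
  have hnodup : (s ++ (p.reverse ++ [Sum.inr o])).Nodup := by
    rw [← List.append_assoc]
    have : (s ++ p.reverse ++ [Sum.inr o]).Perm (Sum.inr o :: (p ++ s)) :=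
      (List.perm_append_singleton _ _).trans (.cons _
        (List.perm_append_comm.trans ((List.reverse_perm p).append_right s)))
    exact this.nodup_iff.2 (List.nodup_cons.2 ⟨hoL, hn⟩)
  obtain ⟨a', b', h', -, -⟩ := exists_isAltPath (t := t) (y := a (k + 1)) (z := o) hchain hnodup
    (by simp; omega) (by rw [List.head?_append_of_ne_nil _ hs, hs₀]) (by simp)
  refine ⟨a', b', _, h', ?_⟩
  have e1 := h'.left (t - 1) (by omega)
  have e2 := h'.right 0 (by omega)
  rw [List.getElem?_append_right (by omega), List.getElem?_append_left (by simp; omega),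
    show 2 * (t - 1) - s.length = p.reverse.length - 1 by simp; omega,
    ← List.getLast?_eq_getElem?, List.getLast?_reverse, hp₁] at e1
  rw [List.getElem?_append_left (by omega), show 2 * 0 + 1 = 1 from rfl, hs₁] at e2
  simp only [Option.some.injEq, Sum.inl.injEq, Sum.inr.injEq] at e1 e2
  rw [← e1, ← e2]
  exact h₁

/-- The part of an alternating path strictly between `a 0` and its last vertex. -/
theorem exists_interior (h : IsAltPath E t a b l) (ht : 0 < t) {o : β}
    (ho : ∀ k < t - 1, b k ≠ o) :
    ∃ L, (Sum.inl (a 0) :: L).IsChain (SumAdj E) ∧ (Sum.inr o :: Sum.inl (a 0) :: L).Nodup ∧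
      L.length = 2 * t - 2 ∧ (∀ i, i + 1 < t → L[2 * i]? = some (.inr (b i))) ∧
      ∀ i, i + 1 < t → L[2 * i + 1]? = some (.inl (a (i + 1))) := by
  have hl := h.length_eq
  obtain ⟨M, z, rfl, hM⟩ := exists_eq_append_of_le_length (l := l) (n := 2 * t - 1) (by omega)
  have hoM : Sum.inr o ∉ M := by
    intro hop
    obtain ⟨i, hi, rfl⟩ := h.mem_iff.1 (List.mem_append_left z hop)
    obtain rfl : i = t - 1 := by
      by_contra hne
      exact ho i (by omega) rfl
    have := h.right (t - 1) (by omega)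
    rw [List.getElem?_append_right (by omega)] at this
    exact List.disjoint_of_nodup_append h.nodup hop (List.mem_of_getElem? this)
  have hc := h.chain.left_of_append
  have hn := h.nodup.of_append_left
  have hL₁ : ∀ i < t, M[2 * i]? = some (.inl (a i)) := fun i hi => by
    rw [← h.left i hi, List.getElem?_append_left (by omega)]
  have hL₂ : ∀ i, i + 1 < t → M[2 * i + 1]? = some (.inr (b i)) := fun i hi => by
    rw [← h.right i (by omega), List.getElem?_append_left (by omega)]
  rcases M with _ | ⟨x, L⟩
  · simp at hM; omega
  obtain rfl : x = Sum.inl (a 0) := by simpa using hL₁ 0 ht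
  exact ⟨L, hc, List.nodup_cons.2 ⟨hoM, hn⟩, by simp at hM; omega, hL₂,
    fun i hi => hL₁ (i + 1) hi⟩

theorem exists_closed_of_lollipop_zero (h : IsAltPath E t a b l) (hE : E (a (t - 1)) (b 0))
    {i : ℕ} (hi : i + 1 < t) (hEi : E (a 0) (b i)) {o : β} (ho : ∀ k < t - 1, b k ≠ o)
    (h₁ : E (a 0) o) (h₂ : E (a (i + 1)) o) :
    ∃ l', IsClosedChain (SumAdj E) l' ∧ l'.length = 2 * t := by
  obtain ⟨L, hc, hn, hL, hL₁, hL₂⟩ := h.exists_interior (by omega) ho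
  obtain ⟨p, q, rfl, hp⟩ := exists_eq_append_of_le_length (l := L) (n := 2 * i + 1) (by omega)
  have hq : q.length = 2 * t - 2 - (2 * i + 1) := by simp at hL; omega
  have hp₀ : p ≠ [] := by rintro rfl; simp at hp
  have hq₀ : q ≠ [] := by rintro rfl; simp at hq; omega
  have hp₁ : p.head? = some (.inr (b 0)) := by
    rw [List.head?_eq_getElem?, ← hL₁ 0 (by omega), List.getElem?_append_left (by omega)]
  have hp₂ : p.getLast? = some (.inr (b i)) := by
    rw [List.getLast?_eq_getElem?, ← hL₁ i (by omega), List.getElem?_append_left (by omega), hp]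
    rfl
  have hq₁ : q.head? = some (.inl (a (i + 1))) := by
    rw [List.head?_eq_getElem?, ← hL₂ i (by omega), List.getElem?_append_right (by omega), hp]
    simp
  have hq₂ : q.getLast? = some (.inl (a (t - 1))) := by
    have := hL₂ (t - 2) (by omega)
    rw [show t - 2 + 1 = t - 1 by omega] at this
    rw [List.getLast?_eq_getElem?, ← this, List.getElem?_append_right (by omega), hp, hq]
    congr 1; omega
  have hperm : (q ++ (p ++ [Sum.inl (a 0)])).Perm (Sum.inl (a 0) :: (p ++ q)) := by
    rw [← List.append_assoc]
    exact (List.perm_append_singleton _ _).trans (.cons _ List.perm_append_comm)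
  refine ⟨_, isClosedChain_cons sumAdj_symm (u := Sum.inr o)
    (isChain_append_append_singleton hc hp₀ ?_ ?_) ?_ ?_ ?_ ?_ ?_, ?_⟩
  · simpa [hp₁, hq₂] using hE
  · simpa [hp₂] using hEi
  · exact hperm.nodup_iff.2 (List.nodup_cons.1 hn).2
  · rw [hperm.mem_iff]
    exact (List.nodup_cons.1 hn).1
  · simp
  · rw [List.head?_append_of_ne_nil _ hq₀, hq₁]
    simpa using h₂
  · rw [← List.append_assoc]
    simpa using h₁
  · rw [List.length_cons, hperm.length_eq, List.length_cons, hL]; omega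

theorem exists_closed_of_lollipop (h : IsAltPath E t a b l) (hE : E (a (t - 1)) (b 0))
    {i j : ℕ} (hij : i < j) (hj : j + 1 < t) (hEi : E (a 0) (b i)) (hEj : E (a 0) (b j))
    {o : β} (ho : ∀ k < t - 1, b k ≠ o) (h₁ : E (a (i + 1)) o) (h₂ : E (a (j + 1)) o) :
    ∃ l', IsClosedChain (SumAdj E) l' ∧ l'.length = 2 * t := by
  obtain ⟨L, hc, hn, hL, hL₁, hL₂⟩ := h.exists_interior (by omega) ho
  obtain ⟨p, M, rfl, hp⟩ := exists_eq_append_of_le_length (l := L) (n := 2 * i + 1) (by omega)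
  have hM : M.length = 2 * t - 2 - (2 * i + 1) := by simp at hL; omega
  obtain ⟨q, s, rfl, hq⟩ := exists_eq_append_of_le_length (l := M) (n := 2 * (j - i)) (by omega)
  have hs : s.length = 2 * t - 2 - (2 * j + 1) := by simp at hM; omega
  have hp₀ : p ≠ [] := by rintro rfl; simp at hp
  have hq₀ : q ≠ [] := by rintro rfl; simp at hq; omega
  have hs₀ : s ≠ [] := by rintro rfl; simp at hs; omega
  have hp₁ : p.head? = some (.inr (b 0)) := by
    rw [List.head?_eq_getElem?, ← hL₁ 0 (by omega), List.getElem?_append_left (by omega)]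
  have hp₂ : p.getLast? = some (.inr (b i)) := by
    rw [List.getLast?_eq_getElem?, ← hL₁ i (by omega), List.getElem?_append_left (by omega), hp]
    rfl
  have hq₁ : q.head? = some (.inl (a (i + 1))) := by
    rw [List.head?_eq_getElem?, ← hL₂ i (by omega), List.getElem?_append_right (by omega),
      List.getElem?_append_left (by omega), hp]
    simp
  have hq₂ : q.getLast? = some (.inr (b j)) := by
    rw [List.getLast?_eq_getElem?, ← hL₁ j (by omega), List.getElem?_append_right (by omega),
      List.getElem?_append_left (by omega), hp, hq]
    congr 1; omega
  have hs₁ : s.head? = some (.inl (a (j + 1))) := by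
    rw [List.head?_eq_getElem?, ← hL₂ j (by omega), List.getElem?_append_right (by omega),
      List.getElem?_append_right (by omega), hp, hq]
    congr 1; omega
  have hs₂ : s.getLast? = some (.inl (a (t - 1))) := by
    have := hL₂ (t - 2) (by omega)
    rw [show t - 2 + 1 = t - 1 by omega] at this
    rw [List.getLast?_eq_getElem?, ← this, List.getElem?_append_right (by omega),
      List.getElem?_append_right (by omega), hp, hq, hs]
    congr 1; omega
  have hperm : (q ++ Sum.inl (a 0) :: (p.reverse ++ s.reverse)).Perm
      (Sum.inl (a 0) :: (p ++ (q ++ s))) :=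
    List.perm_middle.trans (.cons _ (List.perm_append_comm_assoc q _ _ |>.trans
      (((List.reverse_perm p).append ((List.reverse_perm s).append_left q)))))
  refine ⟨_, isClosedChain_cons sumAdj_symm (u := Sum.inr o)
    (isChain_append_cons_reverse sumAdj_symm hc hp₀ ?_ ?_ ?_) ?_ ?_ ?_ ?_ ?_, ?_⟩
  · simpa [hp₁, hs₂] using hE
  · simpa [hp₂] using hEi
  · simpa [hq₂] using hEj
  · exact hperm.nodup_iff.2 (List.nodup_cons.1 hn).2
  · rw [hperm.mem_iff]
    exact (List.nodup_cons.1 hn).1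
  · simp
  · rw [List.head?_append_of_ne_nil _ hq₀, hq₁]
    simpa using h₁
  · rw [List.append_cons, ← List.append_assoc, List.getLast?_append_of_ne_nil _ (by simpa),
      List.getLast?_reverse, hs₁]
    simpa using h₂
  · rw [List.length_cons, hperm.length_eq, List.length_cons, hL]; omega

section
variable [Fintype β]

theorem leftDegree_eq [DecidableEq β] [∀ x, DecidablePred (E x)] (h : IsAltPath E t a b l) (x : α) :
    leftDegree E x = #{k ∈ range (t - 1) | E x (b k)} +
      #{o ∈ ((range (t - 1)).image b)ᶜ | E x o} := by
  have hinj : Set.InjOn b ↑{k ∈ range (t - 1) | E x (b k)} := h.injOn_right.mono fun i hi => by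
    have := mem_range.1 (mem_filter.1 (mem_coe.1 hi)).1
    exact Set.mem_Iio.2 (by omega)
  rw [leftDegree, ← card_image_of_injOn hinj, ← card_union_of_disjoint]
  · congr 1
    ext o
    simp only [mem_filter, mem_univ, mem_union, mem_image, mem_range, mem_compl]
    grind
  · rw [disjoint_left]
    simp only [mem_filter, mem_image, mem_range, mem_compl]
    grind

theorem card_compl_add [DecidableEq β] (h : IsAltPath E t a b l) :
    #((range (t - 1)).image b)ᶜ + (t - 1) = Fintype.card β := by
  have hinj : Set.InjOn b ↑(range (t - 1)) := h.injOn_right.mono fun i hi => by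
    have := mem_range.1 (mem_coe.1 hi)
    exact Set.mem_Iio.2 (by omega)
  have := card_compl_add_card ((range (t - 1)).image b)
  rwa [card_image_of_injOn hinj, card_range] at this

theorem exists_closed_of_le_leftDegree (h : IsAltPath E t a b l) (ht : 2 ≤ t)
    (hmt : Fintype.card β + 2 ≤ 2 * t) (hd : ∀ x, t ≤ leftDegree E x) :
    ∃ l', IsClosedChain (SumAdj E) l' ∧ l'.length = 2 * t := by
  classical
  by_contra hno
  have hex : ∀ (a : ℕ → α) (b : ℕ → β) l, IsAltPath E t a b l → ∀ x,
      ∃ o, (∀ k < t - 1, b k ≠ o) ∧ E x o := by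
    intro a b l h x
    have h1 := hd x
    rw [h.leftDegree_eq] at h1
    have h2 : #{k ∈ range (t - 1) | E x (b k)} ≤ t - 1 := (card_filter_le _ _).trans (by simp)
    obtain ⟨o, ho⟩ := card_pos.1 (show 0 < #{o ∈ ((range (t - 1)).image b)ᶜ | E x o} by omega)
    simp only [mem_filter, mem_compl, mem_image, mem_range] at ho
    exact ⟨o, fun k hk hko => ho.1 ⟨k, hk, hko⟩, ho.2⟩
  obtain ⟨k, hk, hk₁, hk₂⟩ : ∃ k, k + 2 < t ∧ E (a 0) (b (k + 1)) ∧ E (a (t - 1)) (b k) := by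
    have h0 := hd (a 0)
    have h1 := hd (a (t - 1))
    rw [h.leftDegree_eq] at h0 h1
    have hR := h.card_compl_add
    have hd : Disjoint {o ∈ ((range (t - 1)).image b)ᶜ | E (a 0) o}
        {o ∈ ((range (t - 1)).image b)ᶜ | E (a (t - 1)) o} := by
      rw [disjoint_left]
      intro o ho ho'
      simp only [mem_filter, mem_compl, mem_image, mem_range] at ho ho'
      exact hno (h.exists_closed_of_common ht (fun k hk hko => ho.1 ⟨k, hk, hko⟩) ho.2 ho'.2)
    have h2 := card_union_of_disjoint hd
    have h3 := card_le_card (union_subset (filter_subset _ _) (filter_subset _ _) :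
      {o ∈ ((range (t - 1)).image b)ᶜ | E (a 0) o} ∪
        {o ∈ ((range (t - 1)).image b)ᶜ | E (a (t - 1)) o} ⊆ ((range (t - 1)).image b)ᶜ)
    by_contra! hcon
    have h4 : #{k ∈ range (t - 1) | E (a 0) (b k)} ≤
        #{k ∈ range (t - 2) | E (a 0) (b (k + 1))} + 1 := by
      obtain ⟨t, rfl⟩ : ∃ s, t = s + 2 := ⟨t - 2, by omega⟩
      simp only [show t + 2 - 1 = t + 1 by omega, show t + 2 - 2 = t by omega, card_filter]
      rw [sum_range_succ']
      gcongr
      split_ifs <;> simp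
    have h5 : #{k ∈ range (t - 1) | E (a (t - 1)) (b k)} ≤
        #{k ∈ range (t - 2) | E (a (t - 1)) (b k)} + 1 := by
      obtain ⟨t, rfl⟩ : ∃ s, t = s + 2 := ⟨t - 2, by omega⟩
      simp only [show t + 2 - 1 = t + 1 by omega, show t + 2 - 2 = t by omega, card_filter]
      rw [sum_range_succ]
      gcongr
      split_ifs <;> simp
    have h6 : Disjoint {k ∈ range (t - 2) | E (a 0) (b (k + 1))}
        {k ∈ range (t - 2) | E (a (t - 1)) (b k)} := by
      rw [disjoint_left]
      intro k hk hk'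
      simp only [mem_filter, mem_range] at hk hk'
      exact hcon k (by omega) hk.2 hk'.2
    have h7 := card_union_of_disjoint h6
    have h8 := card_le_card (union_subset (filter_subset _ _) (filter_subset _ _) :
      {k ∈ range (t - 2) | E (a 0) (b (k + 1))} ∪
        {k ∈ range (t - 2) | E (a (t - 1)) (b k)} ⊆ range (t - 2))
    rw [card_range] at h8
    omega
  obtain ⟨o, ho, hEo⟩ := hex a b l h (a 0)
  obtain ⟨a', b', l', h', hE⟩ := h.exists_lollipop hk hk₁ hk₂ ho hEo
  choose f hf hEf using fun i => hex a' b' l' h' (a' (i + 1))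
  have hdeg := hd (a' 0)
  rw [h'.leftDegree_eq] at hdeg
  set K := {k ∈ range (t - 1) | E (a' 0) (b' k)} with hK
  have hKt : ∀ i ∈ K, i + 1 < t ∧ E (a' 0) (b' i) := fun i hi => by
    simp only [hK, mem_filter, mem_range] at hi
    exact ⟨by omega, hi.2⟩
  have hlt : ∀ i ∈ K, ∀ j ∈ K, i < j → f i ≠ f j := fun i hi j hj hij hfij =>
    hno (h'.exists_closed_of_lollipop hE hij (hKt j hj).1 (hKt i hi).2 (hKt j hj).2 (hf i)
      (hEf i) (hfij ▸ hEf j))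
  have hinj : Set.InjOn f K := by
    intro i hi j hj hij
    rcases lt_trichotomy i j with hlt' | rfl | hlt'
    · exact absurd hij (hlt i hi j hj hlt')
    · rfl
    · exact absurd hij.symm (hlt j hj i hi hlt')
  have hdisj : Disjoint (K.image f) {o ∈ ((range (t - 1)).image b')ᶜ | E (a' 0) o} := by
    rw [disjoint_left]
    intro o ho ho'
    obtain ⟨i, hi, rfl⟩ := mem_image.1 ho
    exact hno (h'.exists_closed_of_lollipop_zero hE (hKt i hi).1 (hKt i hi).2 (hf i)
      (mem_filter.1 ho').2 (hEf i))
  have hsub : K.image f ∪ {o ∈ ((range (t - 1)).image b')ᶜ | E (a' 0) o} ⊆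
      ((range (t - 1)).image b')ᶜ := by
    refine union_subset ?_ (filter_subset _ _)
    intro o ho
    obtain ⟨i, hi, rfl⟩ := mem_image.1 ho
    simp only [mem_compl, mem_image, mem_range, not_exists, not_and]
    exact hf i
  have := card_le_card hsub
  rw [card_union_of_disjoint hdisj, card_image_of_injOn hinj] at this
  have := h'.card_compl_add
  omega

end

end IsAltPath

section Lists

variable {V : Type*} {r r' : V → V → Prop}

theorem isChain_of_head?_of_getLast? {u v : V}
    (hr' : ∀ x y, r' x y → r x y ∨ (x = u ∧ y = v) ∨ (x = v ∧ y = u)) {l : List V}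
    (hc : l.IsChain r') (hn : l.Nodup) (hl : 3 ≤ l.length) (hu : l.head? = some u)
    (hv : l.getLast? = some v) : l.IsChain r := by
  rw [List.isChain_iff_getElem] at hc ⊢
  rw [List.head?_eq_getElem?] at hu
  rw [List.getLast?_eq_getElem?] at hv
  have h0 : ∀ i (hi : i < l.length), l[i] = u → i = 0 := fun i hi h =>
    (List.getElem?_inj hi hn).1 (by rw [hu, List.getElem?_eq_getElem hi, h])
  have h1 : ∀ i (hi : i < l.length), l[i] = v → i = l.length - 1 := fun i hi h =>
    (List.getElem?_inj hi hn).1 (by rw [hv, List.getElem?_eq_getElem hi, h])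
  intro i hi
  rcases hr' _ _ (hc i hi) with h | ⟨hx, hy⟩ | ⟨hx, hy⟩
  · exact h
  · have := h0 _ _ hx
    have := h1 _ _ hy
    omega
  · have := h0 _ _ hy
    omega

/-- Deleting the only edge `uv` of a cycle that is missing from `r` leaves a path. -/
theorem exists_isChain_of_isClosedChain (hr : ∀ x y, r x y → r y x) {u v : V}
    (hr' : ∀ x y, r' x y → r x y ∨ (x = u ∧ y = v) ∨ (x = v ∧ y = u)) {l : List V}
    (h : IsClosedChain r' l) (hl : 3 ≤ l.length)
    (hno : ¬ ∃ l', IsClosedChain r l' ∧ l'.length = l.length) :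
    ∃ l' : List V, l'.IsChain r ∧ l'.Nodup ∧ l'.length = l.length ∧ l'.head? = some u ∧
      l'.getLast? = some v := by
  obtain ⟨l', hc, hn, hl', x, y, hx, hy, hxy⟩ : ∃ l' : List V, l'.IsChain r' ∧ l'.Nodup ∧
      l'.length = l.length ∧ ∃ x y, l'.head? = some x ∧ l'.getLast? = some y ∧
        ((x = u ∧ y = v) ∨ (x = v ∧ y = u)) := by
    have hne : l ≠ [] := by rintro rfl; simp at hl
    have hx₀ := List.head?_eq_some_head hne
    have hy₀ := List.getLast?_eq_some_getLast hne
    by_cases hc : l.IsChain r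
    · refine ⟨l, h.chain, h.nodup, rfl, _, _, hx₀, hy₀, ?_⟩
      rcases hr' _ _ (h.closing _ hy₀ _ hx₀) with h' | h' | h'
      · refine absurd ⟨l, ⟨hc, h.nodup, ?_⟩, rfl⟩ hno
        simpa [hx₀, hy₀] using h'
      · exact .inr h'.symm
      · exact .inl h'.symm
    · rw [List.isChain_iff_getElem] at hc
      push Not at hc
      obtain ⟨i, hi, hri⟩ := hc
      have h' := (List.isChain_iff_getElem.1 h.chain) i hi
      have hp₂ : (l.take (i + 1)).getLast? = some l[i] := by
        rw [List.getLast?_take]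
        simp [List.getElem?_eq_getElem (show i < l.length by omega)]
      have hq₁ : (l.drop (i + 1)).head? = some l[i + 1] := by
        rw [List.head?_drop, List.getElem?_eq_getElem]
      have hp₁ : (l.take (i + 1)).head? = l.head? := by simp [List.head?_take]
      have hq₂ : (l.drop (i + 1)).getLast? = l.getLast? := by
        rw [List.getLast?_drop, if_neg (by omega)]
      refine ⟨l.drop (i + 1) ++ l.take (i + 1), ?_, ?_, ?_, l[i + 1], l[i], ?_, ?_, ?_⟩
      · rw [List.isChain_append, hp₁, hq₂]
        exact ⟨h.chain.drop _, h.chain.take _, h.closing⟩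
      · rw [List.perm_append_comm.nodup_iff, List.take_append_drop]
        exact h.nodup
      · rw [List.perm_append_comm.length_eq, List.take_append_drop]
      · rw [List.head?_append, hq₁]; rfl
      · rw [List.getLast?_append, hp₂]; rfl
      · rcases hr' _ _ h' with h' | h' | h'
        exacts [absurd h' hri, .inr h'.symm, .inl h'.symm]
  rcases hxy with ⟨rfl, rfl⟩ | ⟨rfl, rfl⟩
  · exact ⟨l', isChain_of_head?_of_getLast? hr' hc hn (by omega) hx hy, hn, hl', hx, hy⟩
  · refine ⟨l'.reverse, List.isChain_reverse.2 ?_, List.nodup_reverse.2 hn, by simpa using hl',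
      by simpa using hy, by simpa using hx⟩
    exact (isChain_of_head?_of_getLast? (fun x y h => (hr' x y h).imp_right Or.symm) hc hn (by omega)
      hx hy).imp fun x y => hr x y

end Lists

section Core

open Finset

variable {α β : Type*} {E : α → β → Prop} {t : ℕ}

theorem exists_isAltPath_of_not_adj (ht : 2 ≤ t) {y : α} {z : β}
    (hno : ¬ ∃ l', IsClosedChain (SumAdj E) l' ∧ l'.length = 2 * t)
    (hyz : ∃ l', IsClosedChain (SumAdj fun a b => E a b ∨ (a = y ∧ b = z)) l' ∧
      l'.length = 2 * t) :
    ∃ a b l, IsAltPath E t a b l ∧ a 0 = y ∧ b (t - 1) = z := by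
  obtain ⟨l, h, hl⟩ := hyz
  obtain ⟨l', hc, hn, hl', hu, hv⟩ := exists_isChain_of_isClosedChain (r := SumAdj E)
    (u := Sum.inl y) (v := Sum.inr z) sumAdj_symm (by
      rintro (x | x) (w | w) hxw
      · exact hxw.elim
      · exact hxw.imp id fun h => by simp [h]
      · exact hxw.imp id fun h => by simp [h]
      · exact hxw.elim) h (by omega) (by rwa [hl])
  obtain ⟨a, b, h⟩ := exists_isAltPath hc hn (hl'.trans hl) hu hv
  exact ⟨a, b, l', h⟩

theorem exists_isClosedChain_of_forall [Fintype α] [Fintype β] (hα : Fintype.card α = t)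
    (ht : 2 ≤ t) (htm : t ≤ Fintype.card β) (hE : ∀ a b, E a b) :
    ∃ l', IsClosedChain (SumAdj E) l' ∧ l'.length = 2 * t := by
  have e : Fin t ≃ α := (Fintype.equivFinOfCardEq hα).symm
  have f : Fin t ↪ β := by
    refine (Function.Embedding.nonempty_of_card_le ?_).some
    simpa using htm
  let g : Fin (2 * t) → α ⊕ β := fun k =>
    if k.1 % 2 = 0 then .inl (e ⟨k / 2, by omega⟩) else .inr (f ⟨k / 2, by omega⟩)
  have hg : ∀ i j : Fin (2 * t), i.1 % 2 ≠ j.1 % 2 → SumAdj E (g i) (g j) := by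
    intro i j hij
    by_cases hi : i.1 % 2 = 0
    · simp [g, hi, show ¬ j.1 % 2 = 0 by omega, hE]
    · simp [g, hi, show j.1 % 2 = 0 by omega, hE]
  refine ⟨List.ofFn g, ⟨?_, ?_, ?_⟩, by simp⟩
  · rw [List.isChain_iff_getElem]
    intro i hi
    simp only [List.getElem_ofFn]
    exact hg _ _ (by simp only; omega)
  · rw [List.nodup_ofFn]
    intro i j hij
    apply Fin.ext
    by_cases hi : i.1 % 2 = 0 <;> by_cases hj : j.1 % 2 = 0 <;> simp [g, hi, hj] at hij <;> omega
  · rw [List.head?_eq_getElem?, List.getLast?_eq_getElem?]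
    intro x hx y hy
    simp only [List.length_ofFn, Option.mem_def, List.getElem?_eq_some_iff,
      List.getElem_ofFn] at hx hy
    obtain ⟨h1, rfl⟩ := hx
    obtain ⟨h2, rfl⟩ := hy
    exact hg _ _ (by simp only; omega)

theorem leftDegree_mono [Fintype β] {E' : α → β → Prop} (h : E ≤ E') (x : α) :
    leftDegree E x ≤ leftDegree E' x := by
  classical
  exact card_le_card (monotone_filter_right _ fun b _ hb => h x b hb)

theorem missing_anti [Fintype α] {E' : α → β → Prop} (h : E ≤ E') (x : β) :
    missing E' x ≤ missing E x := by
  classical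
  exact card_le_card (monotone_filter_right _ fun a _ ha ha' => ha (h a x ha'))

theorem exists_closed_of_card [Fintype α] [Fintype β] (hα : Fintype.card α = t) (ht : 2 ≤ t)
    (htm : t ≤ Fintype.card β)
    (hmt : Fintype.card β + 2 ≤ 2 * t)
    (hE : (∃ δ, (∀ a, δ ≤ leftDegree E a) ∧
      ∑ x, missing E x ≤ t - 2 + (Fintype.card β - t) * δ) ∨ ∀ a, t ≤ leftDegree E a) :
    ∃ l', IsClosedChain (SumAdj E) l' ∧ l'.length = 2 * t := by
  classical
  by_contra hno
  obtain ⟨F, hEF, hF⟩ := (Set.toFinite {F : α → β → Prop |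
    ¬ ∃ l', IsClosedChain (SumAdj F) l' ∧ l'.length = 2 * t}).exists_le_maximal hno
  have hno' := hF.prop
  have hpath : ∀ y z, ¬ F y z → ∃ a b l, IsAltPath F t a b l ∧ a 0 = y ∧ b (t - 1) = z := by
    intro y z hyz
    refine exists_isAltPath_of_not_adj ht hno' ?_
    by_contra hcon
    exact hyz (hF.le_of_ge hcon (fun a b h => Or.inl h) y z (.inr ⟨rfl, rfl⟩))
  have hex : ∃ y z, ¬ F y z := by
    by_contra! hall
    exact hno' (exists_isClosedChain_of_forall hα ht htm hall)
  have hlow : ¬ ∀ a, t ≤ leftDegree F a := by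
    intro hd
    obtain ⟨y, z, hyz⟩ := hex
    obtain ⟨a, b, l, h, -, -⟩ := hpath y z hyz
    exact hno' (h.exists_closed_of_le_leftDegree ht hmt hd)
  rcases hE with ⟨δ, hδ, hM⟩ | hd
  · have : Nonempty α := Fintype.card_pos_iff.1 (by omega)
    obtain ⟨y, hy⟩ := Finite.exists_min (leftDegree F)
    have hyt : leftDegree F y < t := by
      by_contra! hty
      exact hlow fun a => hty.trans (hy a)
    have hne : ({x | ¬ F y x} : Finset β).Nonempty := by
      by_contra! hemp
      have : leftDegree F y = Fintype.card β := by
        rw [leftDegree, ← card_univ]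
        congr 1
        rw [filter_eq_empty_iff] at hemp
        exact filter_true_of_mem fun x hx => not_not.1 (hemp hx)
      omega
    obtain ⟨z, hz, hmin⟩ := exists_min_image _ (missing F) hne
    simp only [mem_filter, mem_univ, true_and] at hz hmin
    obtain ⟨a, b, l, h, rfl, rfl⟩ := hpath y z hz
    have h1 := h.lt_sum_missing hno' hα ht htm hmt hz hmin hyt
    have h2 : ∑ x, missing F x ≤ ∑ x, missing E x := sum_le_sum fun x _ => missing_anti hEF x
    have h3 : (Fintype.card β - t) * δ ≤ (Fintype.card β - t) * leftDegree F (a 0) :=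
      Nat.mul_le_mul_left _ ((hδ _).trans (leftDegree_mono hEF _))
    omega
  · exact hlow fun a => (hd a).trans (leftDegree_mono hEF a)

end Core

section Chains

variable {V W : Type*} {r : V → V → Prop} {l : List V}

theorem IsClosedChain.map {s : W → W → Prop} (h : IsClosedChain r l) {f : V → W}
    (hf : Function.Injective f) (hrs : ∀ x y, r x y → s (f x) (f y)) :
    IsClosedChain s (l.map f) where
  chain := by
    rw [List.isChain_map]
    exact h.chain.imp hrs
  nodup := h.nodup.map hf
  closing := by
    have := h.closing
    simp only [List.getLast?_map, List.head?_map, Option.mem_def, Option.map_eq_some_iff] at this ⊢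
    rintro _ ⟨x, hx, rfl⟩ _ ⟨y, hy, rfl⟩
    exact hrs _ _ (this x hx y hy)

theorem IsClosedChain.reverse (hr : ∀ x y, r x y → r y x) (h : IsClosedChain r l) :
    IsClosedChain r l.reverse where
  chain := by
    rw [List.isChain_reverse]
    exact h.chain.imp hr
  nodup := List.nodup_reverse.2 h.nodup
  closing := by
    simp only [List.getLast?_reverse, List.head?_reverse]
    exact fun x hx y hy => hr _ _ (h.closing y hy x hx)

theorem IsClosedChain.exists_isCycle {G : SimpleGraph V} (h : IsClosedChain G.Adj l)
    (hl : 3 ≤ l.length) : ∃ (v : V) (w : G.Walk v v), w.IsCycle ∧ w.length = l.length := by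
  have hne : l ≠ [] := by rintro rfl; simp at hl
  let p := SimpleGraph.Walk.ofSupport l hne h.chain
  have hlen : p.length = l.length - 1 := SimpleGraph.Walk.length_ofSupport ..
  have hp : p.IsPath := SimpleGraph.Walk.IsPath.mk' (by
    rw [SimpleGraph.Walk.support_ofSupport]; exact h.nodup)
  have hadj : G.Adj (l.getLast hne) (l.head hne) :=
    h.closing _ (List.getLast?_eq_some_getLast hne) _ (List.head?_eq_some_head hne)
  refine ⟨_, .cons hadj p, (SimpleGraph.Walk.cons_isCycle_iff p hadj).2 ⟨hp, fun he => ?_⟩, ?_⟩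
  · rw [Sym2.eq_swap] at he
    have := hp.length_eq_one_of_mem_edges he
    omega
  · rw [SimpleGraph.Walk.length_cons]
    omega

theorem SimpleGraph.Walk.IsCycle.isClosedChain {G : SimpleGraph V} {v : V} {w : G.Walk v v}
    (h : w.IsCycle) : IsClosedChain G.Adj w.support.tail ∧ w.support.tail.length = w.length := by
  refine ⟨⟨w.isChain_adj_support.tail, h.support_nodup, ?_⟩, by simp⟩
  cases w with
  | nil => exact absurd rfl h.ne_nil
  | cons hadj p =>
    rw [SimpleGraph.Walk.support_cons, List.tail_cons, List.getLast?_eq_some_getLast (by simp),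
      List.head?_eq_some_head (by simp)]
    simpa using hadj

end Chains

section Degrees

open Finset

variable {α β : Type*}

theorem sum_missing_add_sum_leftDegree [Fintype α] [Fintype β] (E : α → β → Prop) :
    ∑ x, missing E x + ∑ y, leftDegree E y = Fintype.card α * Fintype.card β := by
  classical
  have h1 : ∑ y, leftDegree E y = ∑ x : β, #{y | E y x} :=
    sum_card_bipartiteAbove_eq_sum_card_bipartiteBelow E
  have h2 (x : β) : missing E x + #{y | E y x} = Fintype.card α := by
    rw [add_comm]
    exact card_filter_add_card_filter_not (s := univ) (fun y => E y x)
  rw [h1, ← sum_add_distrib, sum_congr rfl fun x _ => h2 x]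
  simp [mul_comm]

theorem exists_card_eq_forall_le [Fintype α] (d : α → ℕ) {t : ℕ} (ht : t ≤ Fintype.card α) :
    ∃ A : Finset α, #A = t ∧ ∀ a ∈ A, ∀ x ∉ A, d x ≤ d a := by
  classical
  induction t with
  | zero => exact ⟨∅, by simp⟩
  | succ t ih =>
    obtain ⟨A, hA, h⟩ := ih (by omega)
    obtain ⟨y, hy, hmax⟩ := exists_max_image Aᶜ d (by
      rw [← card_pos, card_compl]; omega)
    rw [mem_compl] at hy
    refine ⟨insert y A, by rw [card_insert_of_notMem hy, hA], fun a ha x hx => ?_⟩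
    rw [mem_insert, not_or] at hx
    rcases mem_insert.1 ha with rfl | ha
    · exact hmax x (by simpa using hx.2)
    · exact h a ha x hx.2

theorem ncard_edgeSet_eq_sum_leftDegree [Fintype α] [Fintype β] (G : SimpleGraph (α ⊕ β))
    (hα : ∀ a b : α, ¬ G.Adj (.inl a) (.inl b)) (hβ : ∀ a b : β, ¬ G.Adj (.inr a) (.inr b)) :
    G.edgeSet.ncard = ∑ j, leftDegree (fun j i => G.Adj (.inr j) (.inl i)) j := by
  classical
  have h1 : G.edgeSet = (fun p : β × α => s(Sum.inr p.1, Sum.inl p.2)) ''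
      {p | G.Adj (.inr p.1) (.inl p.2)} := by
    ext e
    induction e using Sym2.ind with
    | _ x y =>
      simp only [SimpleGraph.mem_edgeSet, Set.mem_image, Set.mem_ofPred_eq, Prod.exists]
      constructor
      · intro h
        rcases x with x | x <;> rcases y with y | y
        · exact absurd h (hα _ _)
        · exact ⟨y, x, h.symm, Sym2.eq_swap⟩
        · exact ⟨x, y, h, rfl⟩
        · exact absurd h (hβ _ _)
      · rintro ⟨j, i, h, he⟩
        rw [← SimpleGraph.mem_edgeSet, ← he]
        exact h
  have h2 : Function.Injective (fun p : β × α => (s(.inr p.1, .inl p.2) : Sym2 (α ⊕ β))) := by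
    rintro ⟨j, i⟩ ⟨j', i'⟩ h
    simpa using h
  rw [h1, Set.ncard_image_of_injective _ h2, Set.ncard_eq_toFinset_card']
  simp only [leftDegree, Set.toFinset_ofPred, card_filter, Fintype.sum_prod_type]

end Degrees

section Turan

open Finset

theorem ncard_edgeSet_le {m n t : ℕ} (ht : 2 ≤ t) (hnm : m ≤ n) (htm : t ≤ m)
    (hmt : m + 2 ≤ 2 * t) (G : SimpleGraph (Fin m ⊕ Fin n))
    (hl : ∀ a b : Fin m, ¬ G.Adj (.inl a) (.inl b)) (hr : ∀ a b : Fin n, ¬ G.Adj (.inr a) (.inr b))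
    (hG : ¬ ∃ (v : Fin m ⊕ Fin n) (w : G.Walk v v), w.IsCycle ∧ w.length = 2 * t) :
    G.edgeSet.ncard ≤ (t - 1) * n + m - t + 1 := by
  rw [ncard_edgeSet_eq_sum_leftDegree G hl hr]
  set E : Fin n → Fin m → Prop := fun j i => G.Adj (.inr j) (.inl i)
  by_contra! he
  obtain ⟨A, hA, hAmax⟩ := exists_card_eq_forall_le (leftDegree E) (t := t) (by simp; omega)
  set E' : A → Fin m → Prop := fun a => E a
  obtain ⟨l, hc, hlen⟩ : ∃ l, IsClosedChain (SumAdj E') l ∧ l.length = 2 * t := by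
    refine exists_closed_of_card (by simpa using hA) ht (by simpa using htm) (by simpa using hmt) ?_
    obtain ⟨y, hy, hmin⟩ := exists_min_image A (leftDegree E) (card_pos.1 (by omega))
    by_cases hδ : t ≤ leftDegree E y
    · exact .inr fun a => hδ.trans (hmin a a.2)
    refine .inl ⟨leftDegree E y, fun a => hmin a a.2, ?_⟩
    have h1 := sum_missing_add_sum_leftDegree E'
    have h2 : ∑ a, leftDegree E' a = ∑ a ∈ A, leftDegree E a := sum_coe_sort A (leftDegree E)
    have h3 : ∑ a ∈ Aᶜ, leftDegree E a ≤ (n - t) * leftDegree E y := by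
      refine (sum_le_card_nsmul _ _ _ fun x hx => hAmax y hy x (by simpa using hx)).trans ?_
      simp [card_compl, hA]
    have h4 := sum_add_sum_compl A (leftDegree E)
    rw [h2] at h1
    simp only [Fintype.card_coe, hA, Fintype.card_fin] at h1 ⊢
    obtain ⟨s, rfl⟩ : ∃ s, t = s + 2 := ⟨t - 2, by omega⟩
    obtain ⟨p, rfl⟩ := Nat.exists_eq_add_of_le htm
    obtain ⟨q, rfl⟩ := Nat.exists_eq_add_of_le hnm
    obtain ⟨k, hk⟩ := Nat.exists_eq_add_of_le (show leftDegree E y ≤ s + 1 by omega)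
    rw [show s + 2 + p + q - (s + 2) = p + q by omega] at h3
    rw [show s + 2 + p - (s + 2) = p by omega, Nat.add_sub_cancel]
    rw [show s + 2 - 1 = s + 1 by omega,
      show (s + 1) * (s + 2 + p + q) + (s + 2 + p) - (s + 2) = (s + 1) * (s + 2 + p + q) + p by
        omega] at he
    have h5 : q * (s + 1) = q * leftDegree E y + q * k := by rw [hk, mul_add]
    nlinarith
  obtain ⟨v, w, hw, hw'⟩ := (hc.map (s := G.Adj)
    (f := Sum.elim (fun a : A => Sum.inr a.1) Sum.inl)
    ((Sum.inr_injective.comp Subtype.val_injective).sumElim Sum.inl_injective (by simp))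
    (by
      rintro (x | x) (y | y) h <;>
        first | exact h | exact SimpleGraph.Adj.symm h | simp at h)).exists_isCycle
    (by rw [List.length_map]; omega)
  exact hG ⟨v, w, hw, by rw [hw', List.length_map, hlen]⟩

variable {α β : Type*}

/-- The bipartite graph on `α ⊕ β` whose edges are given by `E`. -/
def bipartiteGraph (E : α → β → Prop) : SimpleGraph (α ⊕ β) where
  Adj := SumAdj E
  symm := ⟨sumAdj_symm⟩
  loopless := ⟨by rintro (x | x) <;> simp⟩

theorem exists_isAltPath_of_isClosedChain {E : α → β → Prop} {t : ℕ} {l : List (α ⊕ β)}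
    (ht : 0 < t) (h : IsClosedChain (SumAdj E) l) (hl : l.length = 2 * t) :
    ∃ a b l', IsAltPath E t a b l' ∧ E (a 0) (b (t - 1)) := by
  have key {l : List (α ⊕ β)} (h : IsClosedChain (SumAdj E) l) (hl : l.length = 2 * t) {y : α}
      {z : β} (hy : l.head? = some (.inl y)) (hz : l.getLast? = some (.inr z)) :
      ∃ a b l', IsAltPath E t a b l' ∧ E (a 0) (b (t - 1)) := by
    obtain ⟨a, b, hp, rfl, rfl⟩ := exists_isAltPath h.chain h.nodup hl hy hz
    exact ⟨a, b, l, hp, by simpa using h.closing _ hz _ hy⟩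
  have hne : l ≠ [] := by rintro rfl; simp at hl; omega
  have h1 := List.head?_eq_some_head hne
  have h2 := List.getLast?_eq_some_getLast hne
  have h3 := h.closing _ h2 _ h1
  rcases hu : l.head hne with y | y <;> rcases hv : l.getLast hne with z | z <;>
    simp only [hu, hv, not_sumAdj_inl, not_sumAdj_inr] at h1 h2 h3
  · exact key h hl h1 h2
  · exact key (h.reverse (sumAdj_symm)) (by simpa using hl) (by simpa using h2) (by simpa using h1)

theorem IsAltPath.exists_ne {E : α → β → Prop} {t : ℕ} {a : ℕ → α} {b : ℕ → β}
    {l : List (α ⊕ β)} (h : IsAltPath E t a b l) (hE : E (a 0) (b (t - 1))) (ht : 2 ≤ t) {i : ℕ}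
    (hi : i < t) (o : β) : ∃ x ≠ o, E (a i) x := by
  by_cases hb : b i = o
  · rcases i with _ | i
    · refine ⟨_, fun ho => ?_, hE⟩
      have := h.injOn_right (show t - 1 < t by omega) hi (ho.trans hb.symm)
      omega
    · refine ⟨_, fun ho => ?_, h.adj_left hi⟩
      have := h.injOn_right (show i < t by omega) hi (ho.trans hb.symm)
      omega
  · exact ⟨_, hb, h.adj_right hi⟩

theorem exists_ncard_edgeSet_eq {m n t : ℕ} (ht : 2 ≤ t) (hn : 0 < n) (htm : t ≤ m) :
    ∃ G : SimpleGraph (Fin m ⊕ Fin n),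
      (∀ a b : Fin m, ¬ G.Adj (.inl a) (.inl b)) ∧
      (∀ a b : Fin n, ¬ G.Adj (.inr a) (.inr b)) ∧
      (¬ ∃ (v : Fin m ⊕ Fin n) (w : G.Walk v v), w.IsCycle ∧ w.length = 2 * t) ∧
      G.edgeSet.ncard = (t - 1) * n + m - t + 1 := by
  obtain ⟨n, rfl⟩ : ∃ k, n = k + 1 := ⟨n - 1, by omega⟩
  set E : Fin m → Fin (n + 1) → Prop := fun i j => i.1 < t - 1 ∨ j = 0 with hE
  refine ⟨bipartiteGraph E, by simp [bipartiteGraph], by simp [bipartiteGraph], ?_, ?_⟩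
  · rintro ⟨v, w, hw, hlen⟩
    obtain ⟨hc, hl⟩ := hw.isClosedChain
    obtain ⟨a, b, l, hp, hab⟩ := exists_isAltPath_of_isClosedChain (by omega) hc (hl.trans hlen)
    have hlt : ∀ i ∈ range t, (a i).1 ∈ range (t - 1) := by
      intro i hi
      obtain ⟨x, hx, hx'⟩ := hp.exists_ne hab ht (mem_range.1 hi) 0
      exact mem_range.2 (hx'.resolve_right hx)
    have := card_le_card_of_injOn (fun i => (a i).1) hlt fun i hi j hj hij =>
      hp.injOn_left (mem_range.1 hi) (mem_range.1 hj) (Fin.ext hij)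
    simp at this
    omega
  · rw [ncard_edgeSet_eq_sum_leftDegree _ (by simp [bipartiteGraph]) (by simp [bipartiteGraph]),
      Fin.sum_univ_succ]
    have h0 : leftDegree (fun (j : Fin (n + 1)) (i : Fin m) =>
        (bipartiteGraph E).Adj (.inr j) (.inl i)) 0 = m := by
      simp [leftDegree, bipartiteGraph, hE]
    have h1 (j : Fin n) : leftDegree (fun (j : Fin (n + 1)) (i : Fin m) =>
        (bipartiteGraph E).Adj (.inr j) (.inl i)) j.succ = t - 1 := by
      simp [leftDegree, bipartiteGraph, hE, Fin.card_filter_val_lt]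
      omega
    rw [h0, sum_congr rfl fun j _ => h1 j]
    simp only [sum_const, card_univ, Fintype.card_fin, smul_eq_mul]
    rw [mul_add, mul_comm n]
    omega

end Turan

theorem stmt_2 (m n t : ℕ) (hm : 0 < m) (hn : 0 < n) (ht : 0 < t)
    (hnm : m ≤ n) (htm : t ≤ m) (hlow : (m : ℚ) / 2 + 1 ≤ (t : ℚ)) :
    IsGreatest {N : ℕ | ∃ G : SimpleGraph (Fin m ⊕ Fin n),
        (∀ a b : Fin m, ¬ G.Adj (Sum.inl a) (Sum.inl b)) ∧
        (∀ a b : Fin n, ¬ G.Adj (Sum.inr a) (Sum.inr b)) ∧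
        (¬ ∃ (v : Fin m ⊕ Fin n) (w : G.Walk v v), w.IsCycle ∧ w.length = 2 * t) ∧
        G.edgeSet.ncard = N}
      ((t - 1) * n + m - t + 1) := by
  have hmt : m + 2 ≤ 2 * t := by
    have : (m : ℚ) + 2 ≤ 2 * t := by linarith
    exact_mod_cast this
  refine ⟨exists_ncard_edgeSet_eq (by omega) hn htm, ?_⟩
  rintro N ⟨G, hl, hr, hG, rfl⟩
  exact ncard_edgeSet_le (by omega) hnm htm hmt G hl hr hG
end

section
/- Let G be a balanced bipartite graph of order 2n, where n ≥ 2k+2 and k is a natural number. If e(G) ≥ (n−k−1)n + k + 2, then the circumference of G satisfies c(G) ≥ 2n−2k. -/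
namespace BipartiteCircumference

open Finset

variable {V : Type*} {G : SimpleGraph V}

/-- `l` lists the vertices of a path of `G` from `a` to `b`. -/
structure IsPathList (G : SimpleGraph V) (a b : V) (l : List V) : Prop where
  chain : l.IsChain G.Adj
  nodup : l.Nodup
  head : l.head? = some a
  last : l.getLast? = some b

/-- Some closed path list of `G` has at least `m` vertices. -/
def HasLongCycle (G : SimpleGraph V) (m : ℕ) : Prop :=
  ∃ a b l, IsPathList G a b l ∧ G.Adj b a ∧ m ≤ l.length

namespace IsPathList

variable {a b c d : V} {l m : List V}

theorem single (G : SimpleGraph V) (a : V) : IsPathList G a a [a] := by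
  constructor <;> simp

theorem head_mem (h : IsPathList G a b l) : a ∈ l := List.mem_of_head? h.head

theorem last_mem (h : IsPathList G a b l) : b ∈ l := List.mem_of_getLast? h.last

theorem reverse (h : IsPathList G a b l) : IsPathList G b a l.reverse where
  chain := by
    rw [List.isChain_reverse]
    exact h.chain.imp fun _ _ h => h.symm
  nodup := List.nodup_reverse.2 h.nodup
  head := by rw [List.head?_reverse, h.last]
  last := by rw [List.getLast?_reverse, h.head]

theorem append (h : IsPathList G a b l) (h' : IsPathList G c d m) (hbc : G.Adj b c)
    (hd : ∀ v ∈ l, v ∉ m) : IsPathList G a d (l ++ m) where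
  chain := by
    rw [List.isChain_append]
    refine ⟨h.chain, h'.chain, ?_⟩
    simp [h.last, h'.head, hbc]
  nodup := List.nodup_append'.2 ⟨h.nodup, h'.nodup, fun v hv hv' => hd v hv hv'⟩
  head := by simp [List.head?_append, h.head]
  last := by simp [List.getLast?_append, h'.last]

theorem cons (h : IsPathList G a b l) (hca : G.Adj c a) (hc : c ∉ l) :
    IsPathList G c b (c :: l) :=
  (single G c).append h hca (by simpa using hc)

theorem snoc (h : IsPathList G a b l) (hbc : G.Adj b c) (hc : c ∉ l) :
    IsPathList G a c (l ++ [c]) :=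
  h.append (single G c) hbc (by rintro v hv hv'; simp at hv'; subst hv'; exact hc hv)

theorem init (h : IsPathList G a b (l ++ c :: m)) : IsPathList G a c (l ++ [c]) where
  chain := h.chain.infix ⟨[], m, by simp⟩
  nodup := h.nodup.sublist (by simp)
  head := by have := h.head; simpa [List.head?_append] using this
  last := by simp

theorem tail (h : IsPathList G a b (l ++ c :: m)) : IsPathList G c b (c :: m) where
  chain := h.chain.infix ⟨l, [], by simp⟩
  nodup := h.nodup.sublist (by simp)
  head := by simp
  last := by have := h.last; simpa [List.getLast?_append] using this

theorem notMem_of_split (h : IsPathList G a b (l ++ m)) : ∀ v ∈ l, v ∉ m := by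
  have := List.nodup_append'.1 h.nodup
  exact fun v hv hv' => this.2.2 hv hv'

theorem exists_cons (h : IsPathList G a b l) : ∃ m, l = a :: m := by
  have := h.head
  cases l with
  | nil => simp at this
  | cons x m => simp at this; subst this; exact ⟨m, rfl⟩

theorem mono {H : SimpleGraph V} (hH : G ≤ H) (h : IsPathList G a b l) : IsPathList H a b l :=
  ⟨h.chain.imp fun _ _ h => hH h, h.nodup, h.head, h.last⟩

/-- Split a list at the first element satisfying `p`. -/
theorem _root_.List.exists_split_first {p : V → Prop} {l : List V} (h : ∃ v ∈ l, p v) :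
    ∃ l₁ v l₂, l = l₁ ++ v :: l₂ ∧ p v ∧ ∀ u ∈ l₁, ¬ p u := by
  induction l with
  | nil => simp at h
  | cons a l ih =>
    by_cases ha : p a
    · exact ⟨[], a, l, rfl, ha, by simp⟩
    · obtain ⟨l₁, v, l₂, rfl, hv, hl⟩ := ih (by simpa [ha] using h)
      exact ⟨a :: l₁, v, l₂, rfl, hv, by simpa [ha] using hl⟩

/-- Split a list at the last element satisfying `p`. -/
theorem _root_.List.exists_split_last {p : V → Prop} {l : List V} (h : ∃ v ∈ l, p v) :
    ∃ l₁ v l₂, l = l₁ ++ v :: l₂ ∧ p v ∧ ∀ u ∈ l₂, ¬ p u := by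
  obtain ⟨l₁, v, l₂, hl, hv, h₁⟩ := List.exists_split_first (p := p) (l := l.reverse) (by simpa using h)
  refine ⟨l₂.reverse, v, l₁.reverse, ?_, hv, by simpa using h₁⟩
  rw [← List.reverse_reverse l, hl]
  simp

theorem exists_isCycle {l : List V} (h : IsPathList G a b l) (hba : G.Adj b a)
    (hl : 3 ≤ l.length) : ∃ w : G.Walk b b, w.IsCycle ∧ w.length = l.length := by
  obtain ⟨m, rfl⟩ := h.exists_cons
  obtain ⟨w, hw⟩ : ∃ w : G.Walk a b, w.support = a :: m := by
    have h1 := h.last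
    rw [List.getLast?_eq_some_getLast (by simp)] at h1
    refine ⟨(SimpleGraph.Walk.ofSupport (a :: m) (by simp) h.chain).copy rfl (by simpa using h1), ?_⟩
    exact (SimpleGraph.Walk.support_copy ..).trans (SimpleGraph.Walk.support_ofSupport ..)
  have hp : w.IsPath := by
    rw [SimpleGraph.Walk.isPath_def, hw]
    exact h.nodup
  have hlen : w.length + 1 = (a :: m).length := by rw [← hw, SimpleGraph.Walk.length_support]
  refine ⟨.cons hba w, (SimpleGraph.Walk.cons_isCycle_iff _ _).2 ⟨hp, fun he => ?_⟩, ?_⟩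
  · have := hp.length_eq_one_of_mem_edges (Sym2.eq_swap ▸ he)
    omega
  · simpa using hlen

end IsPathList

theorem HasLongCycle.mono {H : SimpleGraph V} (hH : G ≤ H) {m : ℕ} (h : HasLongCycle G m) :
    HasLongCycle H m := by
  obtain ⟨a, b, l, h, hba, hm⟩ := h
  exact ⟨a, b, l, h.mono hH, hH hba, hm⟩

theorem two_mul_card_le_length [DecidableEq V] {c : V → Prop} {N : Finset V} {l : List V}
    (hN : ∀ v ∈ N, v ∈ l) (hc : ∀ a, l.head? = some a → c a)
    (h : l.IsChain fun u v => (c u → u ∈ N → v ∉ N) ∧ (c u ↔ ¬ c v)) :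
    2 * #N ≤ l.length + 1 := by
  have key : ∀ (n : ℕ) (l : List V), l.length = n → (∀ a, l.head? = some a → c a) →
      (l.IsChain fun u v => (c u → u ∈ N → v ∉ N) ∧ (c u ↔ ¬ c v)) →
      2 * (l.filter (· ∈ N)).length ≤ l.length + 1 := by
    intro n
    induction n using Nat.strong_induction_on with
    | _ n ih =>
      intro l hn hc h
      match l, hn, hc, h with
      | [], _, _, _ => simp
      | [a], _, _, _ =>
        have := List.length_filter_le (· ∈ N) [a]
        simp only [List.length_singleton] at *
        omega
      | a :: b :: l, hn, hc, h =>
        rw [List.isChain_cons_cons, List.isChain_cons] at h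
        have hca : c a := hc a rfl
        have hab := h.1.1 hca
        have := ih l.length (by simp at hn; omega) l rfl ?_ h.2.2
        · by_cases ha : a ∈ N
          · simp [ha, hab ha]; omega
          · by_cases hb : b ∈ N <;> simp [ha, hb] <;> omega
        · intro e he
          obtain ⟨m, rfl⟩ := List.head?_eq_some_iff.1 he
          have h3 := h.2.1 e rfl
          have h4 := h.1.2
          tauto
  have h1 := key _ l rfl hc h
  have h2 : #N ≤ (l.filter (· ∈ N)).length := by
    refine le_trans (card_le_card (t := (l.filter (· ∈ N)).toFinset) ?_) (List.toFinset_card_le _)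
    intro v hv
    simp [hv, hN v hv]
  omega


theorem IsPathList.two_mul_card_le {X Y : Set V} (hG : G.IsBipartiteWith X Y) {a b : V}
    {l : List V} (h : IsPathList G a b l) {N : Finset V} (hN : ∀ v ∈ N, v ∈ l)
    (hind : ∀ u ∈ N, ∀ v ∈ N, ¬ G.Adj u v) : 2 * #N ≤ l.length + 1 := by
  classical
  refine two_mul_card_le_length (c := fun u => u ∈ X ↔ a ∈ X) hN ?_ ?_
  · intro a' ha'
    rw [h.head] at ha'
    simp_all
  · refine h.chain.imp fun u v huv => ⟨fun _ hu hv => hind u hu v hv huv, ?_⟩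
    have h1 := Set.disjoint_left.1 hG.disjoint
    have := hG.mem_of_adj huv
    grind

/-- The neighbours of `x` in `B`. -/
noncomputable def nbrs (G : SimpleGraph V) (B : Finset V) (x : V) : Finset V := by
  classical exact B.filter (G.Adj x)

@[simp] theorem mem_nbrs {B : Finset V} {x y : V} : y ∈ nbrs G B x ↔ y ∈ B ∧ G.Adj x y := by
  simp [nbrs]

/-- The edges of `G` lie in `S`, and no vertex separates `S` in `G`. -/
structure NoCutVertex (G : SimpleGraph V) (S : Set V) : Prop where
  mem_of_adj : ∀ ⦃a b⦄, G.Adj a b → b ∈ S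
  mem_of_closed : ∀ (v : V) (D : Set V), D ⊆ S → D.Nonempty → v ∉ D →
    (∀ a ∈ D, ∀ b, G.Adj a b → b = v ∨ b ∈ D) → ∀ u ∈ S, u ≠ v → u ∈ D

theorem NoCutVertex.exists_ear {S : Set V} (hS : NoCutVertex G S) {x : V} {Z W : Set V}
    (hZ : ∃ z ∈ Z, z ∈ S ∧ z ≠ x) (hW : ∃ w ∈ W, w ∈ S ∧ w ≠ x) :
    ∃ a b l, IsPathList G a b l ∧ x ∉ l ∧ a ∈ Z ∧ b ∈ W ∧ (∀ v ∈ l, v ∈ Z → v = a) ∧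
      ∀ v ∈ l, v ∈ W → v = b := by
  obtain ⟨z, hz, hzS, hzx⟩ := hZ
  obtain ⟨w, hw, hwS, hwx⟩ := hW
  let D : Set V := {u | u ∈ S ∧ ∃ a l, IsPathList G a u l ∧ x ∉ l ∧ a ∈ Z ∧ ∀ v ∈ l, v ∈ Z → v = a}
  have hsing : ∀ u ∈ Z, u ∈ S → u ≠ x → u ∈ D := fun u hu huS hux =>
    ⟨huS, u, [u], .single G u, by simpa using hux.symm, hu, by simp⟩
  have hwD : w ∈ D := by
    refine hS.mem_of_closed x D (fun u hu => hu.1) ⟨z, hsing z hz hzS hzx⟩ ?_ ?_ w hwS hwx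
    · rintro ⟨-, a, l, hl, hx, -⟩
      exact hx hl.last_mem
    · rintro u ⟨huS, a, l, hl, hx, ha, hlZ⟩ b hub
      have hbS := hS.mem_of_adj hub
      by_cases hbx : b = x
      · exact .inl hbx
      right
      by_cases hbl : b ∈ l
      · obtain ⟨l₁, l₂, rfl⟩ := List.append_of_mem hbl
        exact ⟨hbS, a, _, hl.init, by simp_all, ha, fun v hv => hlZ v (by simp at hv ⊢; tauto)⟩
      by_cases hbZ : b ∈ Z
      · exact hsing b hbZ hbS hbx
      · refine ⟨hbS, a, _, hl.snoc hub hbl, by simp [hx, Ne.symm hbx], ha, ?_⟩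
        intro v hv hvZ
        simp only [List.mem_append, List.mem_singleton] at hv
        rcases hv with hv | rfl
        · exact hlZ v hv hvZ
        · exact absurd hvZ hbZ
  obtain ⟨-, a, l, hl, hx, ha, hlZ⟩ := hwD
  obtain ⟨l₁, b, l₂, rfl, hb, hl₁⟩ := List.exists_split_first ⟨w, hl.last_mem, hw⟩
  refine ⟨a, b, _, hl.init, by simp_all, ha, hb, fun v hv => hlZ v (by simp at hv ⊢; tauto), ?_⟩
  intro v hv hvW
  simp only [List.mem_append, List.mem_singleton] at hv
  rcases hv with hv | rfl
  · exact absurd hvW (hl₁ v hv)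
  · rfl

theorem IsPathList.join {a b c : V} {l m : List V} (h : IsPathList G a b l)
    (h' : IsPathList G b c m) (hd : ∀ v ∈ l, v ∈ m → v = b) :
    ∃ q, IsPathList G a c q ∧ (∀ v, v ∈ q ↔ v ∈ l ∨ v ∈ m) ∧
      q.length + 1 = l.length + m.length := by
  obtain ⟨m', rfl⟩ := h'.exists_cons
  cases m' with
  | nil =>
    have : b = c := by simpa using h'.last
    subst this
    refine ⟨l, h, fun v => ?_, rfl⟩
    have := h.last_mem
    grind
  | cons d m' =>
    have h2 : IsPathList G d c (d :: m') := IsPathList.tail (l := [b]) h'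
    have h3 : G.Adj b d := (List.isChain_cons_cons.1 h'.chain).1
    have h4 := h'.nodup
    refine ⟨l ++ d :: m', h.append h2 h3 ?_, fun v => ?_, by simp; omega⟩
    · grind
    · have := h.last_mem
      grind

theorem IsPathList.trim {a b z : V} {l : List V} (h : IsPathList G a b l) (hz : z ∈ l) :
    ∃ q, IsPathList G a z q ∧ (∀ v ∈ q, v ∈ l) ∧ (z ≠ b → b ∉ q) := by
  obtain ⟨l₁, l₂, rfl⟩ := List.append_of_mem hz
  refine ⟨_, h.init, by simp; tauto, fun hzb hb => ?_⟩
  have h1 := h.tail.last_mem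
  have h2 := h.notMem_of_split
  grind

/-- Two disjoint path lists from `A` to `B`, of which one ends in `x` and one starts in `a₀`. -/
def Linked (G : SimpleGraph V) (A : Set V) (a₀ x : V) (B : Set V) : Prop :=
  ∃ s s' w l m, IsPathList G s x l ∧ IsPathList G s' w m ∧ s ∈ A ∧ s' ∈ A ∧ (s = a₀ ∨ s' = a₀) ∧
    w ∈ B ∧ (∀ v ∈ l, v ∉ m) ∧ (∀ v ∈ l, v ∈ A → v = s) ∧ (∀ v ∈ m, v ∈ A → v = s') ∧
    (∀ v ∈ l, v ∈ B → v = x) ∧ ∀ v ∈ m, v ∈ B → v = w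

theorem NoCutVertex.linked_self {S A B : Set V} (hS : NoCutVertex G S) {a₀ : V}
    (ha : a₀ ∈ A) (hA : ∃ z ∈ A, z ∈ S ∧ z ≠ a₀) (hB : ∃ w ∈ B, w ∈ S ∧ w ≠ a₀) :
    Linked G A a₀ a₀ B := by
  obtain ⟨s', w, m, hm, h0, hs', hw, hmA, hmB⟩ := hS.exists_ear hA hB
  exact ⟨a₀, s', w, [a₀], m, .single G a₀, hm, ha, hs', .inl rfl, hw, by simpa using h0,
    by simp, hmA, by simp, hmB⟩

theorem NoCutVertex.linked_step {S A B : Set V} (hS : NoCutVertex G S) {a₀ x y : V}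
    (ha : a₀ ∈ A) (haS : a₀ ∈ S) (hyA : y ∉ A) (hxB : x ∉ B) (hyB : y ∈ B) (hxy : G.Adj x y)
    (hB : ∃ w ∈ B, w ∈ S ∧ w ≠ y) (h : Linked G A a₀ x (insert x B)) : Linked G A a₀ y B := by
  obtain ⟨s, s', w, l, m, hl, hm, hs, hs', hss, hw, hlm, hlA, hmA, hlB, hmB⟩ := h
  have hyl : y ∉ l := fun hy => hxB (hlB y hy (.inr hyB) ▸ hyB)
  have hxl := hl.last_mem
  have hwm := hm.last_mem
  have hwB : w ∈ B := hw.resolve_left (by rintro rfl; exact hlm _ hxl hwm)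
  have hlB' : ∀ v ∈ l, v ∉ B := fun v hv hvB => hxB (hlB v hv (.inr hvB) ▸ hvB)
  have hly := hl.snoc hxy hyl
  by_cases hwy : w = y
  · subst hwy
    obtain ⟨z, w', e, he, hye, hz, hw', heZ, heB⟩ :=
      hS.exists_ear (x := w) (Z := {v | v ∈ l ∨ v ∈ m ∨ v ∈ A}) (W := B)
        ⟨a₀, .inr (.inr ha), haS, by rintro rfl; exact hyA ha⟩ hB
    simp only [Set.mem_ofPred_eq] at hz heZ
    by_cases hzl : z ∈ l
    · obtain ⟨l', hl', hll, -⟩ := hl.trim hzl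
      obtain ⟨q, hq, hqm, -⟩ := hl'.join he (by grind)
      refine ⟨s', s, w', m, q, hm, hq, hs', hs, hss.symm, hw', ?_, hmA, ?_, ?_, ?_⟩
      all_goals grind
    by_cases hzm : z ∈ m
    · have hzw : z ≠ w := by
        rintro rfl; exact hye he.head_mem
      obtain ⟨m', hm', hmm, hwm'⟩ := hm.trim hzm
      obtain ⟨q, hq, hqm, -⟩ := hm'.join he (by grind)
      refine ⟨s, s', w', _, q, hly, hq, hs, hs', hss, hw', ?_, ?_, ?_, ?_, ?_⟩
      all_goals grind
    have hzA : z ∈ A := by tauto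
    rcases hss with rfl | rfl
    · refine ⟨s, z, w', _, e, hly, he, hs, hzA, .inl rfl, hw', ?_, ?_, ?_, ?_, ?_⟩
      all_goals grind
    · refine ⟨s', z, w', m, e, hm, he, hs', hzA, .inl rfl, hw', ?_, ?_, ?_, ?_, ?_⟩
      all_goals grind
  · have hym : y ∉ m := fun hy => hwy (hmB y hy (.inr hyB)).symm
    refine ⟨s, s', w, _, m, hly, hm, hs, hs', hss, hwB, ?_, ?_, hmA, ?_, fun v hv hvB => hmB v hv (.inr hvB)⟩
    all_goals grind

theorem NoCutVertex.linked_of_path {S A : Set V} (hS : NoCutVertex G S) {a₀ y b z : V}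
    {M L : List V} (ha : a₀ ∈ A) (haS : a₀ ∈ S) (hz : z ∈ L) (hzS : z ∈ S) :
    ∀ {x}, IsPathList G x b (x :: M ++ y :: L) → (∀ v ∈ M ++ y :: L, v ∉ A) →
      Linked G A a₀ x {v | v ∈ x :: M ++ y :: L} → Linked G A a₀ y {v | v ∈ y :: L} := by
  induction M with
  | nil =>
    intro x h hM hl
    have h1 := h.chain
    have h2 := h.nodup
    simp at h1 h2 hM
    refine hS.linked_step (x := x) ha haS hM.1 ?_ ?_ h1.1 ⟨z, ?_, hzS, ?_⟩ ?_
    · simp; tauto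
    · simp
    · simp [hz]
    · rintro rfl; tauto
    · convert hl using 1; ext; simp
  | cons u M ih =>
    intro x h hM hl
    have h1 := h.chain
    have h2 := h.nodup
    simp at h1 h2 hM
    refine ih (IsPathList.tail (l := [x]) h) ?_ ?_
    · simp; grind
    refine hS.linked_step (x := x) ha haS hM.1 ?_ ?_ h1.1 ⟨z, ?_, hzS, ?_⟩ ?_
    · simp; tauto
    · simp
    · simp [hz]
    · rintro rfl; simp_all
    · convert hl using 1; ext; simp

theorem IsPathList.exists_core {v α u : V} {l : List V} (h : IsPathList G v α l)
    (hα : G.Adj v α) (hu : u ∈ l) (huα : u ≠ α) :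
    ∃ q, IsPathList G u α q ∧ (∀ w ∈ q, w ∈ l) ∧ ∀ w ∈ l, G.Adj v w → w ∈ q := by
  obtain ⟨l₁, l₂, rfl⟩ := List.append_of_mem hu
  have hα2 : α ∈ l₂ := (List.mem_cons.1 h.tail.last_mem).resolve_left huα.symm
  obtain ⟨m₁, g, m₂, rfl, hg, hm⟩ := List.exists_split_first ⟨α, hα2, hα⟩
  have hnd := h.nodup
  have h2 : IsPathList G g α (g :: m₂) := IsPathList.tail (l := l₁ ++ u :: m₁) (by simpa using h)
  refine ⟨_, h.init.reverse.append h2 hg ?_, ?_, ?_⟩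
  · intro w hw hw'
    simp at hw hw'
    grind
  · simp
    grind
  · simp
    grind

theorem IsPathList.hasLongCycle_of_two {a b : V} {l m : List V} (hl : IsPathList G a b l)
    (hm : IsPathList G a b m) (hab : a ≠ b) (hlm : ∀ v ∈ l, v ∈ m → v = a ∨ v = b) :
    HasLongCycle G l.length := by
  obtain ⟨m', rfl⟩ := hm.exists_cons
  cases m' with
  | nil => exact absurd (by simpa using hm.last) hab
  | cons c m' =>
    have h2 : IsPathList G c b (c :: m') := IsPathList.tail (l := [a]) hm
    have h3 : G.Adj a c := (List.isChain_cons_cons.1 hm.chain).1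
    have h4 := hm.nodup
    obtain ⟨q, hq, -, hlen⟩ := hl.join h2.reverse (by simp; grind)
    refine ⟨a, c, q, hq, h3.symm, ?_⟩
    simp at hlen
    omega

theorem _root_.List.isChain_of_forall_split {R : V → V → Prop} {l : List V}
    (h : ∀ l₁ u v l₂, l = l₁ ++ u :: v :: l₂ → R u v) : l.IsChain R := by
  induction l with
  | nil => simp
  | cons a l ih =>
    rw [List.isChain_cons]
    refine ⟨fun b hb => ?_, ih fun l₁ u v l₂ hl => h (a :: l₁) u v l₂ (by simp [hl])⟩
    obtain ⟨m, rfl⟩ := List.head?_eq_some_iff.1 hb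
    exact h [] a b m rfl

theorem _root_.SimpleGraph.IsBipartiteWith.mem_right {X Y : Set V} (hG : G.IsBipartiteWith X Y)
    {u v : V} (h : G.Adj u v) (hu : u ∈ X) : v ∈ Y := by
  have h1 := Set.disjoint_left.1 hG.disjoint
  have := hG.mem_of_adj h
  grind

theorem _root_.SimpleGraph.IsBipartiteWith.mem_left {X Y : Set V} (hG : G.IsBipartiteWith X Y)
    {u v : V} (h : G.Adj u v) (hu : u ∈ Y) : v ∈ X :=
  hG.symm.mem_right h hu

theorem IsPathList.hasLongCycle_of_crossing {X Y : Set V} (hG : G.IsBipartiteWith X Y)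
    {x y i j : V} {l₁ m l₂ : List V} (hP : IsPathList G x y (l₁ ++ i :: m ++ j :: l₂))
    (hxX : x ∈ X) (hyY : y ∈ Y) {Nx Ny : Finset V} (hNx : ∀ u, u ∈ Nx ↔ G.Adj x u)
    (hNy : ∀ u, u ∈ Ny ↔ G.Adj y u) (hyi : G.Adj y i) (hxj : G.Adj x j)
    (hNxP : ∀ u ∈ Nx, u ∈ l₁ ++ i :: m ++ j :: l₂) (hNyP : ∀ u ∈ Ny, u ∈ l₁ ++ i :: m ++ j :: l₂)
    (hm : ∀ u ∈ m, u ∉ Nx ∧ u ∉ Ny)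
    (hno : ∀ k₁ u v k₂, l₁ ++ i :: m ++ j :: l₂ = k₁ ++ u :: v :: k₂ → G.Adj y u → ¬ G.Adj x v) :
    HasLongCycle G (2 * (#Nx + #Ny) - 2) := by
  classical
  have hXY := Set.disjoint_left.1 hG.disjoint
  have hdisj : Disjoint Nx Ny := by
    rw [Finset.disjoint_left]
    intro u hu hu'
    exact hXY (hG.mem_left ((hNy u).1 hu') hyY) (hG.mem_right ((hNx u).1 hu) hxX)
  have hP1 : IsPathList G x i (l₁ ++ [i]) := IsPathList.init (m := m ++ j :: l₂) (by simpa using hP)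
  have hP2 : IsPathList G j y (j :: l₂) := hP.tail
  have hPd : ∀ v ∈ l₁ ++ [i], v ∉ j :: l₂ := by
    intro v hv
    exact hP.notMem_of_split v (by simp at hv ⊢; tauto)
  have hR : (l₁ ++ i :: m ++ j :: l₂).IsChain fun u v =>
      G.Adj u v ∧ (u ∈ X → u ∈ Nx ∪ Ny → v ∉ Nx ∪ Ny) := by
    refine List.isChain_of_forall_split fun k₁ u v k₂ hk => ?_
    have huv : G.Adj u v := by
      have := hP.chain
      rw [hk] at this
      exact (List.isChain_cons_cons.1 (this.infix ⟨k₁, [], by simp⟩ : (u :: v :: k₂).IsChain _)).1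
    refine ⟨huv, fun hu huN hvN => ?_⟩
    have := hno k₁ u v k₂ hk
    have hv := hG.mem_right huv hu
    have h3 : u ∉ Nx := fun h => hXY hu (hG.mem_right ((hNx u).1 h) hxX)
    have h4 : v ∉ Ny := fun h => hXY (hG.mem_left ((hNy v).1 h) hyY) hv
    grind
  have h1 : 2 * #((Nx ∪ Ny).filter (· ∈ l₁ ++ [i])) ≤ (l₁ ++ [i]).length + 1 := by
    refine two_mul_card_le_length (c := (· ∈ X)) (by simp) ?_ ?_
    · rw [hP1.head]; simp [hxX]
    · refine (hR.infix ⟨[], m ++ j :: l₂, by simp⟩).imp fun u v huv => ⟨?_, ?_⟩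
      · simp only [mem_filter]; tauto
      · have := hG.mem_of_adj huv.1
        grind
  have h2 : 2 * #((Nx ∪ Ny).filter (· ∈ j :: l₂)) ≤ (j :: l₂).reverse.length + 1 := by
    refine two_mul_card_le_length (c := (· ∈ Y)) (fun v hv => ?_) ?_ ?_
    · exact List.mem_reverse.2 (mem_filter.1 hv).2
    · rw [hP2.reverse.head]; simp [hyY]
    · rw [List.isChain_reverse]
      refine (hR.infix ⟨l₁ ++ i :: m, [], by simp⟩).imp fun u v huv => ⟨?_, ?_⟩
      · simp only [mem_filter]
        have := fun hv => hG.mem_left huv.1.symm hv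
        tauto
      · have := hG.mem_of_adj huv.1
        grind
  have h3 : #(Nx ∪ Ny) ≤ #((Nx ∪ Ny).filter (· ∈ l₁ ++ [i])) + #((Nx ∪ Ny).filter (· ∈ j :: l₂)) := by
    rw [← card_union_of_disjoint]
    · refine card_le_card fun v hv => ?_
      have : v ∈ l₁ ++ i :: m ++ j :: l₂ := by
        rcases mem_union.1 hv with h | h
        · exact hNxP v h
        · exact hNyP v h
      have := hm v
      grind
    · rw [Finset.disjoint_left]
      intro v hv hv'
      exact hPd v (mem_filter.1 hv).2 (mem_filter.1 hv').2
  rw [card_union_of_disjoint hdisj] at h3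
  refine ⟨x, j, _, hP1.append hP2.reverse hyi.symm fun v hv hv' => hPd v hv (List.mem_reverse.1 hv'), hxj.symm, ?_⟩
  rw [List.length_append]
  omega

theorem IsPathList.hasLongCycle_of_noncrossing {X Y S : Set V} (hG : G.IsBipartiteWith X Y)
    (hS : NoCutVertex G S)
    {x y α β : V} {l₁ m l₂ : List V} (hP : IsPathList G x y (l₁ ++ α :: m ++ β :: l₂))
    (hxX : x ∈ X) (hyY : y ∈ Y) {Nx Ny : Finset V} (hNx : ∀ u, u ∈ Nx ↔ G.Adj x u)
    (hNy : ∀ u, u ∈ Ny ↔ G.Adj y u) (hxα : G.Adj x α) (hyβ : G.Adj y β)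
    (hNxP : ∀ u ∈ Nx, u ∈ l₁ ++ [α]) (hNyP : ∀ u ∈ Ny, u ∈ β :: l₂) :
    HasLongCycle G (2 * (#Nx + #Ny) - 2) := by
  have hXY := Set.disjoint_left.1 hG.disjoint
  have hPA : IsPathList G x α (l₁ ++ [α]) := IsPathList.init (m := m ++ β :: l₂) (by simpa using hP)
  have hPB : IsPathList G β y (β :: l₂) := hP.tail
  have hPM : IsPathList G α y (α :: m ++ β :: l₂) := IsPathList.tail (l := l₁) (by simpa using hP)
  have hnd := hP.nodup
  have hl : Linked G {v | v ∈ l₁ ++ [α]} α β {v | v ∈ β :: l₂} := by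
    refine hS.linked_of_path (z := y) (by simp) (hS.mem_of_adj hxα) ?_ (hS.mem_of_adj hyβ.symm)
      hPM ?_ ?_
    · exact (List.mem_cons.1 hPB.last_mem).resolve_left hyβ.ne
    · simp
      grind
    · refine hS.linked_self (by simp) ⟨x, hPA.head_mem, hS.mem_of_adj hxα.symm, hxα.ne⟩
        ⟨β, by simp, hS.mem_of_adj hyβ, ?_⟩
      rintro rfl
      grind
  have hAB : ∀ v ∈ l₁ ++ [α], v ∉ β :: l₂ := by
    intro v hv
    exact hP.notMem_of_split v (by simp at hv ⊢; tauto)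
  obtain ⟨s, e₁, e₂, p, q, hp, hq, hs, hsα, he, hpq, hpA, hqA, hpB, hqB⟩ : ∃ s e₁ e₂ p q,
      IsPathList G α e₁ p ∧ IsPathList G s e₂ q ∧ s ∈ l₁ ++ [α] ∧ s ≠ α ∧
      (e₁ = β ∧ e₂ ∈ β :: l₂ ∧ e₂ ≠ β ∨ e₂ = β ∧ e₁ ∈ β :: l₂ ∧ e₁ ≠ β) ∧
      (∀ v ∈ p, v ∉ q) ∧ (∀ v ∈ p, v ∈ l₁ ++ [α] → v = α) ∧ (∀ v ∈ q, v ∈ l₁ ++ [α] → v = s) ∧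
      (∀ v ∈ p, v ∈ β :: l₂ → v = e₁) ∧ ∀ v ∈ q, v ∈ β :: l₂ → v = e₂ := by
    obtain ⟨s, s', w, p, q, hp, hq, hs, hs', hss, hw, hpq, hpA, hqA, hpB, hqB⟩ := hl
    have h1 := hp.head_mem
    have h2 := hq.head_mem
    have h3 := hp.last_mem
    have h4 := hq.last_mem
    rcases hss with rfl | rfl
    · exact ⟨s', β, w, p, q, hp, hq, hs', by grind, .inl ⟨rfl, hw, by grind⟩, hpq, hpA, hqA, hpB, hqB⟩
    · exact ⟨s, w, β, q, p, hq, hp, hs, by grind, .inr ⟨rfl, hw, by grind⟩,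
        fun v hv hv' => hpq v hv' hv, hqA, hpA, hqB, hpB⟩
  obtain ⟨a, ha, haA, haN⟩ := hPA.exists_core hxα hs hsα
  obtain ⟨b, hb, hbB, hbN⟩ : ∃ b, IsPathList G e₁ e₂ b ∧ (∀ w ∈ b, w ∈ β :: l₂) ∧ ∀ w ∈ Ny, w ∈ b := by
    rcases he with ⟨rfl, he, he'⟩ | ⟨rfl, he, he'⟩
    · obtain ⟨b, hb, hbB, hbN⟩ := hPB.reverse.exists_core hyβ (List.mem_reverse.2 he) he'
      exact ⟨b.reverse, hb.reverse, fun w hw => List.mem_reverse.1 (hbB w (by simpa using hw)),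
        fun w hw => by simpa using hbN w (List.mem_reverse.2 (hNyP w hw)) ((hNy w).1 hw)⟩
    · obtain ⟨b, hb, hbB, hbN⟩ := hPB.reverse.exists_core hyβ (List.mem_reverse.2 he) he'
      exact ⟨b, hb, fun w hw => List.mem_reverse.1 (hbB w hw),
        fun w hw => hbN w (List.mem_reverse.2 (hNyP w hw)) ((hNy w).1 hw)⟩
  have hA := ha.two_mul_card_le hG (N := Nx) (fun w hw => haN w (hNxP w hw) ((hNx w).1 hw))
    fun u hu v hv huv => hXY (hG.mem_left huv (hG.mem_right ((hNx u).1 hu) hxX))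
      (hG.mem_right ((hNx v).1 hv) hxX)
  have hB := hb.two_mul_card_le hG (N := Ny) hbN
    fun u hu v hv huv => hXY (hG.mem_left ((hNy v).1 hv) hyY)
      (hG.mem_right huv (hG.mem_left ((hNy u).1 hu) hyY))
  have hp2 : 2 ≤ p.length := by
    obtain ⟨p', rfl⟩ := hp.exists_cons
    cases p' with
    | nil =>
      have h1 : α = e₁ := by simpa using hp.last
      have h2 := hAB α (by simp)
      grind
    | cons => simp
  obtain ⟨r, hr, hrm, hrl⟩ := ha.join hp fun v hv hv' => hpA v hv' (haA v hv)
  obtain ⟨r', hr', hrm', hrl'⟩ := hr.join hb fun v hv hv' => by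
    have := hbB v hv'
    rcases (hrm v).1 hv with h | h
    · exact absurd this (hAB v (haA v h))
    · exact hpB v h this
  have hse : s ≠ e₂ := by
    rintro rfl
    exact hAB s hs (hbB s hb.last_mem)
  obtain ⟨c, d, k, h1, h2, h3⟩ := hr'.hasLongCycle_of_two hq hse (by grind)
  exact ⟨c, d, k, h1, h2, by omega⟩

theorem IsPathList.hasLongCycle_or {X Y S : Set V} (hG : G.IsBipartiteWith X Y)
    (hS : NoCutVertex G S) {x y : V} {l : List V} (hP : IsPathList G x y l)
    (hxX : x ∈ X) (hyY : y ∈ Y) {Nx Ny : Finset V} (hNx : ∀ u, u ∈ Nx ↔ G.Adj x u)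
    (hNy : ∀ u, u ∈ Ny ↔ G.Adj y u) (hNx0 : Nx.Nonempty) (hNy0 : Ny.Nonempty)
    (hNxP : ∀ u ∈ Nx, u ∈ l) (hNyP : ∀ u ∈ Ny, u ∈ l) :
    HasLongCycle G (2 * (#Nx + #Ny) - 2) ∨
      ∃ k₁ u v k₂, l = k₁ ++ u :: v :: k₂ ∧ G.Adj y u ∧ G.Adj x v := by
  by_contra! hcon
  obtain ⟨hc, hno⟩ := hcon
  refine hc ?_
  obtain ⟨α₀, hα₀⟩ := hNx0
  obtain ⟨β₀, hβ₀⟩ := hNy0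
  obtain ⟨l₁, α, l₂, rfl, hα, hl₂⟩ := List.exists_split_last ⟨α₀, hNxP α₀ hα₀, hα₀⟩
  have hxα := (hNx α).1 hα
  by_cases hi : ∃ i ∈ l₁, i ∈ Ny
  · obtain ⟨k₁, i, k₂, rfl, hi, hk₂⟩ := List.exists_split_last hi
    obtain ⟨m, j, m', hmj, hj, hm⟩ := List.exists_split_first (l := k₂ ++ [α]) (p := (· ∈ Nx)) ⟨α, by simp, hα⟩
    have heq : (k₁ ++ i :: k₂) ++ α :: l₂ = k₁ ++ i :: m ++ j :: (m' ++ l₂) := by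
      have : (k₁ ++ i :: k₂) ++ α :: l₂ = k₁ ++ i :: ((k₂ ++ [α]) ++ l₂) := by simp
      rw [this, hmj]; simp
    rw [heq] at hP hNxP hNyP hno
    refine hP.hasLongCycle_of_crossing hG hxX hyY hNx hNy ((hNy i).1 hi) ((hNx j).1 hj) hNxP hNyP
      ?_ hno
    intro u hu
    refine ⟨hm u hu, fun huy => ?_⟩
    have : u ∈ k₂ ++ [α] := by rw [hmj]; simp [hu]
    grind
  · have hXY := Set.disjoint_left.1 hG.disjoint
    have hN2 : ∀ u ∈ Ny, u ∈ l₂ := by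
      intro u hu
      have h1 := hNyP u hu
      have : u ≠ α := by
        rintro rfl
        exact hXY (hG.mem_left ((hNy u).1 hu) hyY) (hG.mem_right hxα hxX)
      grind
    obtain ⟨m, β, k, rfl, hβ, hm⟩ := List.exists_split_first ⟨β₀, hN2 β₀ hβ₀, hβ₀⟩
    refine IsPathList.hasLongCycle_of_noncrossing (l₁ := l₁) (α := α) (m := m) (β := β) (l₂ := k)
      hG hS (by simpa using hP) hxX hyY hNx hNy hxα ((hNy β).1 hβ) ?_ ?_
    · intro u hu
      have := hNxP u hu
      grind
    · intro u hu
      have := hN2 u hu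
      grind

theorem IsPathList.rotate {a b c : V} {l : List V} (h : IsPathList G a b l) (hba : G.Adj b a)
    (hc : c ∈ l) : ∃ d q, IsPathList G c d q ∧ G.Adj d c ∧ (∀ v, v ∈ q ↔ v ∈ l) ∧
      q.length = l.length := by
  obtain ⟨l₁, l₂, rfl⟩ := List.append_of_mem hc
  rcases List.eq_nil_or_concat l₁ with rfl | ⟨m, e, rfl⟩
  · have : c = a := by simpa using h.head
    subst this
    exact ⟨b, _, h, hba, by simp, rfl⟩
  · have h1 : IsPathList G a e (m ++ [e]) := IsPathList.init (m := c :: l₂) (by simpa using h)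
    have h2 : G.Adj e c := by
      have : List.IsChain G.Adj (e :: c :: l₂) := h.chain.infix ⟨m, [], by simp⟩
      exact (List.isChain_cons_cons.1 this).1
    have h3 := h.notMem_of_split
    refine ⟨e, _, h.tail.append h1 hba ?_, h2, ?_, ?_⟩
    · intro v hv hv'
      exact h3 v (by simpa using hv') hv
    · intro v
      simp
      tauto
    · simp
      omega

/-- A path list from `XS` to `YE` containing, with each vertex, its partner under `mt`; if `Q`
holds, each vertex of `X` is followed by its partner. -/
structure MatchedPath (G : SimpleGraph V) (X XS YE : Set V) (mt : V → V → Prop) (Q : Prop) (x y : V)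
    (P : List V) : Prop where
  path : IsPathList G x y P
  head_mem : x ∈ XS
  last_mem : y ∈ YE
  closed : ∀ u w, mt u w → (u ∈ P ↔ w ∈ P)
  matched : P.IsChain fun u v => Q → u ∈ X → mt u v

theorem closed_insert {X Y : Set V} (hXY : ∀ ⦃a⦄, a ∈ X → a ∉ Y) {mt : V → V → Prop}
    (hmt : ∀ u w, mt u w → u ∈ X ∧ w ∈ Y ∧ G.Adj u w)
    (hmtl : ∀ u u' w, mt u w → mt u' w → u = u') (hmtr : ∀ u w w', mt u w → mt u w' → w = w')
    {u w : V} (huw : mt u w) {p : V → Prop} (hp : ∀ a b, mt a b → (p a ↔ p b))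
    (a b : V) (hab : mt a b) : (a = u ∨ a = w ∨ p a) ↔ (b = u ∨ b = w ∨ p b) := by
  have h1 := hmt u w huw
  have h2 := hmt a b hab
  have h3 := hp a b hab
  have h4 : a ≠ w := by rintro rfl; exact hXY h2.1 h1.2.1
  have h5 : b ≠ u := by rintro rfl; exact hXY h1.1 h2.2.1
  have h6 : a = u ↔ b = w :=
    ⟨by rintro rfl; exact hmtr _ _ _ hab huw, by rintro rfl; exact hmtl _ _ _ hab huw⟩
  tauto

theorem exists_maximal_matchedPath [Finite V] {X Y XS YE : Set V} (hG : G.IsBipartiteWith X Y)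
    {mt : V → V → Prop} {Q : Prop}
    (hmt : ∀ u w, mt u w → u ∈ X ∧ w ∈ Y ∧ G.Adj u w)
    (hmtl : ∀ u u' w, mt u w → mt u' w → u = u') (hmtr : ∀ u w w', mt u w → mt u w' → w = w')
    (hXS : ∀ x ∈ XS, ∀ w, G.Adj x w → ∃ u ∈ XS, mt u w)
    (hYE : ∀ y ∈ YE, ∀ u, G.Adj y u → ∃ w ∈ YE, mt u w)
    (hYEY : YE ⊆ Y)
    (h0 : ∃ x y P, MatchedPath G X XS YE mt Q x y P) :
    ∃ x y P, MatchedPath G X XS YE mt Q x y P ∧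
      (∀ x' y' P', MatchedPath G X XS YE mt Q x' y' P' → P'.length ≤ P.length) ∧
      (∀ w, G.Adj x w → w ∈ P) ∧ ∀ u, G.Adj y u → u ∈ P := by
  classical
  have := Fintype.ofFinite V
  have hXY := Set.disjoint_left.1 hG.disjoint
  let p : ℕ → Prop := fun m => ∃ x y P, MatchedPath G X XS YE mt Q x y P ∧ P.length = m
  obtain ⟨x₀, y₀, P₀, hP₀⟩ := h0
  have hb : ∀ x y P, MatchedPath G X XS YE mt Q x y P → P.length ≤ Fintype.card V :=
    fun x y P hP => hP.path.nodup.length_le_card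
  obtain ⟨x, y, P, hP, hlen⟩ : p (Nat.findGreatest p (Fintype.card V)) :=
    Nat.findGreatest_spec (m := P₀.length) (hb _ _ _ hP₀) ⟨x₀, y₀, P₀, hP₀, rfl⟩
  have hmax : ∀ x' y' P', MatchedPath G X XS YE mt Q x' y' P' → P'.length ≤ P.length := by
    intro x' y' P' hP'
    rw [hlen]
    exact Nat.le_findGreatest (hb _ _ _ hP') ⟨x', y', P', hP', rfl⟩
  have hPh := hP.path.head
  have hPl := hP.path.last
  refine ⟨x, y, P, hP, hmax, fun w hw => ?_, fun u hu => ?_⟩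
  · by_contra hwP
    obtain ⟨u, hu, huw⟩ := hXS x hP.head_mem w hw
    have huP : u ∉ P := fun h => hwP ((hP.closed u w huw).1 h)
    obtain ⟨huX, hwY, hadj⟩ := hmt u w huw
    have := hmax u y (u :: w :: P)
      ⟨(hP.path.cons hw.symm hwP).cons hadj (by simp [huP, hadj.ne]), hu, hP.last_mem, ?_, ?_⟩
    · simp at this
    · intro a b hab
      simpa only [List.mem_cons] using closed_insert hXY hmt hmtl hmtr huw hP.closed a b hab
    · rw [List.isChain_cons_cons, List.isChain_cons]
      exact ⟨fun _ _ => huw, fun b _ _ hwX => absurd hwY (hXY hwX), hP.matched⟩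
  · by_contra huP
    obtain ⟨w, hw, huw⟩ := hYE y hP.last_mem u hu
    have hwP : w ∉ P := fun h => huP ((hP.closed u w huw).2 h)
    obtain ⟨huX, hwY, hadj⟩ := hmt u w huw
    have := hmax x w (P ++ [u] ++ [w])
      ⟨(hP.path.snoc hu huP).snoc hadj (by simp [hwP, hadj.ne']), hP.head_mem, hw, ?_, ?_⟩
    · simp at this
    · intro a b hab
      have := closed_insert hXY hmt hmtl hmtr huw hP.closed a b hab
      simp only [List.mem_append, List.mem_singleton]
      tauto
    · rw [List.append_assoc, List.isChain_append]
      refine ⟨hP.matched, by simp; exact fun _ _ => huw, ?_⟩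
      rw [hPl]
      simp only [Option.mem_def, Option.some.injEq, forall_eq']
      exact fun _ _ _ hyX => absurd (hYEY hP.last_mem) (hXY hyX)

theorem hasLongCycle_of_perfect [Finite V] {X Y : Finset V} (hG : G.IsBipartiteWith (X : Set V) Y)
    (hS : NoCutVertex G (X ∪ Y : Set V)) {mt : V → V → Prop} {t : ℕ}
    (hmt : ∀ u w, mt u w → u ∈ X ∧ w ∈ Y ∧ G.Adj u w)
    (hmtl : ∀ u u' w, mt u w → mt u' w → u = u') (hmtr : ∀ u w w', mt u w → mt u w' → w = w')
    (hX : ∀ x ∈ X, ∃ w, mt x w) (hY : ∀ w ∈ Y, ∃ u, mt u w) (hX0 : X.Nonempty)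
    (htX : t ≤ #X) (htY : t ≤ #Y)
    (hdX : ∀ x ∈ X, 1 ≤ #(nbrs G Y x)) (hdY : ∀ y ∈ Y, 1 ≤ #(nbrs G X y))
    (hd : ∀ x ∈ X, ∀ y ∈ Y, t + 1 ≤ #(nbrs G Y x) + #(nbrs G X y)) :
    HasLongCycle G (2 * t) := by
  classical
  have hXY := Set.disjoint_left.1 hG.disjoint
  have hNX : ∀ x ∈ X, ∀ u, u ∈ nbrs G Y x ↔ G.Adj x u := by
    intro x hx u
    simp only [mem_nbrs, and_iff_right_iff_imp]
    exact fun h => hG.mem_right h hx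
  have hNY : ∀ y ∈ Y, ∀ u, u ∈ nbrs G X y ↔ G.Adj y u := by
    intro x hx u
    simp only [mem_nbrs, and_iff_right_iff_imp]
    exact fun h => hG.mem_left h hx
  obtain ⟨x, y, P, hP, hmax, hxP, hyP⟩ := exists_maximal_matchedPath (XS := (X : Set V)) (YE := (Y : Set V))
    (Q := False) hG hmt hmtl hmtr
    (fun x hx w hw => by
      obtain ⟨u, hu⟩ := hY w (hG.mem_right hw hx)
      exact ⟨u, (hmt u w hu).1, hu⟩)
    (fun y hy u hu => by
      obtain ⟨w, hw⟩ := hX u (hG.mem_left hu hy)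
      exact ⟨w, (hmt u w hw).2.1, hw⟩) subset_rfl
    (by
      obtain ⟨x, hx⟩ := hX0
      obtain ⟨w, hw⟩ := hX x hx
      have h1 := hmt x w hw
      refine ⟨x, w, [x, w], (IsPathList.single G w).cons h1.2.2 (by simpa using h1.2.2.ne), hx, h1.2.1, ?_, ?_⟩
      · intro a b hab
        simpa using closed_insert (p := fun _ => False) hXY hmt hmtl hmtr hw (by simp) a b hab
      · simp)
  have hxX : x ∈ X := hP.head_mem
  have hyY : y ∈ Y := hP.last_mem
  rcases hP.path.hasLongCycle_or hG hS hxX hyY (hNX x hxX) (hNY y hyY)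
    (card_pos.1 (hdX x hxX)) (card_pos.1 (hdY y hyY))
    (fun u hu => hxP u ((hNX x hxX u).1 hu)) (fun u hu => hyP u ((hNY y hyY u).1 hu)) with
    h | ⟨k₁, u, v, k₂, hk, hyu, hxv⟩
  · obtain ⟨a, b, l, h1, h2, h3⟩ := h
    have := hd x hxX y hyY
    exact ⟨a, b, l, h1, h2, by omega⟩
  · obtain ⟨C, hC, hCm, hCl⟩ : ∃ C, IsPathList G x v C ∧ (∀ w, w ∈ C ↔ w ∈ P) ∧ C.length = P.length := by
      have hp := hP.path
      rw [hk] at hp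
      have h1 : IsPathList G v y (v :: k₂) := IsPathList.tail (l := k₁ ++ [u]) (by simpa using hp)
      have h2 := hp.nodup
      refine ⟨_, hp.init.append h1.reverse hyu.symm ?_, ?_, ?_⟩
      · intro w hw hw'
        simp at hw hw'
        grind
      · intro w
        simp [hk]
        tauto
      · simp [hk]
    by_cases hall : ∀ w ∈ X ∪ Y, w ∈ P
    · refine ⟨x, v, C, hC, hxv.symm, ?_⟩
      have h1 : #(X ∪ Y) ≤ C.length := by
        refine le_trans (card_le_card (t := C.toFinset) fun w hw => ?_) (List.toFinset_card_le _)
        simpa using (hCm w).2 (hall w hw)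
      rw [card_union_of_disjoint (by exact_mod_cast hG.disjoint)] at h1
      omega
    · exfalso
      push Not at hall
      obtain ⟨o, ho, hoP⟩ := hall
      obtain ⟨c, hc, o, hco, hoP⟩ : ∃ c ∈ P, ∃ o, G.Adj c o ∧ o ∉ P := by
        by_contra! hcon
        obtain ⟨o', hoo'⟩ : ∃ o', G.Adj o o' := by
          rcases mem_union.1 ho with h | h
          · obtain ⟨z, hz⟩ := card_pos.1 (hdX o h)
            exact ⟨z, (mem_nbrs.1 hz).2⟩
          · obtain ⟨z, hz⟩ := card_pos.1 (hdY o h)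
            exact ⟨z, (mem_nbrs.1 hz).2⟩
        have h1 := hS.mem_of_closed o {w | w ∈ (X ∪ Y : Set V) ∧ w ∈ P} (fun w hw => hw.1)
          ⟨x, .inl hxX, hP.path.head_mem⟩ (fun h => hoP h.2)
          (fun a ha b hab => .inr ⟨hS.mem_of_adj hab, hcon a ha.2 b hab⟩)
          o' (hS.mem_of_adj hoo') hoo'.ne'
        exact hoP (hcon o' h1.2 o hoo'.symm)
      obtain ⟨d, q, hq, hdc, hqm, hql⟩ := hC.rotate hxv.symm ((hCm c).2 hc)
      have hqP : ∀ w, w ∈ q ↔ w ∈ P := fun w => (hqm w).trans (hCm w)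
      rcases hS.mem_of_adj hco with hoX | hoY
      · obtain ⟨w, hw⟩ := hX o hoX
        have h1 := hmt o w hw
        have hwP : w ∉ P := fun h => hoP ((hP.closed o w hw).2 h)
        have hdX : d ∈ X := hG.mem_left hdc.symm (hG.mem_right hco.symm hoX) |> fun h => h
        have := hmax d w (w :: o :: q).reverse ⟨((hq.cons hco.symm (by rwa [hqP])).cons h1.2.2.symm
          (by simp [hqP, hwP, h1.2.2.ne'])).reverse, hdX, h1.2.1, ?_, ?_⟩
        · simp at this
          omega
        · intro a b hab
          have := closed_insert hXY hmt hmtl hmtr hw hP.closed a b hab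
          simp only [List.mem_reverse, List.mem_cons, hqP]
          tauto
        · simpa using List.isChain_of_forall_split (fun _ _ _ _ _ => trivial)
      · obtain ⟨u, hu⟩ := hY o hoY
        have h1 := hmt u o hu
        have huP : u ∉ P := fun h => hoP ((hP.closed u o hu).1 h)
        have hdY : d ∈ Y := hG.mem_right hdc.symm (hG.mem_left hco.symm hoY)
        have := hmax u d (u :: o :: q) ⟨(hq.cons hco.symm (by rwa [hqP])).cons h1.2.2
          (by simp [hqP, huP, h1.2.2.ne]), h1.1, hdY, ?_, ?_⟩
        · simp at this
          omega
        · intro a b hab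
          simpa only [List.mem_cons, hqP] using
            closed_insert hXY hmt hmtl hmtr hu hP.closed a b hab
        · simpa using List.isChain_of_forall_split (fun _ _ _ _ _ => trivial)

theorem exists_matching_of_hall [DecidableEq V] {S B : Finset V}
    (h : ∀ T ⊆ S, #T ≤ #(T.biUnion (nbrs G B))) :
    ∃ f : V → V, Set.InjOn f S ∧ ∀ x ∈ S, f x ∈ B ∧ G.Adj x (f x) := by
  obtain ⟨f, hf, hfm⟩ := (Finset.all_card_le_biUnion_card_iff_exists_injective
    (fun x : S => nbrs G B x)).1 fun T => by
      have := h (T.map (Function.Embedding.subtype _)) (fun v hv => by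
        obtain ⟨w, -, rfl⟩ := mem_map.1 hv
        exact w.2)
      rw [card_map] at this
      convert this using 2
      ext v
      simp
  classical
  refine ⟨fun v => if h : v ∈ S then f ⟨v, h⟩ else v, ?_, ?_⟩
  · intro a ha b hb hab
    simp only [mem_coe] at ha hb
    simp only [ha, hb, dif_pos] at hab
    simpa using hf hab
  · intro x hx
    simpa [hx] using hfm ⟨x, hx⟩

/-- A bipartite degree-sum condition for long cycles in graphs without cut vertices. -/
theorem hasLongCycle_of_degrees [Finite V] {X Y : Finset V} (hG : G.IsBipartiteWith (X : Set V) Y)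
    (hS : NoCutVertex G (X ∪ Y : Set V)) {t : ℕ} (hcard : #X = #Y) (hX0 : X.Nonempty)
    (htX : t ≤ #X)
    (hdX : ∀ x ∈ X, 1 ≤ #(nbrs G Y x)) (hdY : ∀ y ∈ Y, 1 ≤ #(nbrs G X y))
    (hd : ∀ x ∈ X, ∀ y ∈ Y, t + 1 ≤ #(nbrs G Y x) + #(nbrs G X y)) :
    HasLongCycle G (2 * t) := by
  classical
  have hXY := Set.disjoint_left.1 hG.disjoint
  obtain ⟨A, hA, hAmax⟩ := exists_max_image X.powerset
    (fun A => #A + #(Y \ A.biUnion (nbrs G Y))) ⟨∅, by simp⟩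
  rw [mem_powerset] at hA
  by_cases hdef : #A + #(Y \ A.biUnion (nbrs G Y)) ≤ #X
  · obtain ⟨f, hfi, hf⟩ := exists_matching_of_hall (G := G) (S := X) (B := Y) fun T hT => by
      have h1 := hAmax T (mem_powerset.2 hT)
      have h2 : T.biUnion (nbrs G Y) ⊆ Y := biUnion_subset.2 fun x _ v hv => (mem_nbrs.1 hv).1
      have h3 := card_sdiff_add_card_eq_card h2
      omega
    have himg : X.image f = Y := eq_of_subset_of_card_le
      (image_subset_iff.2 fun x hx => (hf x hx).1) (by rw [card_image_of_injOn hfi, hcard])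
    refine hasLongCycle_of_perfect hG hS (mt := fun u w => u ∈ X ∧ w = f u) ?_ ?_ ?_ ?_ ?_ hX0 htX
      (hcard ▸ htX) hdX hdY hd
    · rintro u w ⟨hu, rfl⟩
      exact ⟨hu, hf u hu⟩
    · rintro u u' w ⟨hu, rfl⟩ ⟨hu', h⟩
      exact hfi hu hu' h
    · rintro u w w' ⟨-, rfl⟩ ⟨-, rfl⟩
      rfl
    · exact fun x hx => ⟨f x, hx, rfl⟩
    · intro w hw
      rw [← himg] at hw
      obtain ⟨u, hu, rfl⟩ := mem_image.1 hw
      exact ⟨u, hu, rfl⟩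
  push Not at hdef
  set B := A.biUnion (nbrs G Y) with hB
  have hBY : B ⊆ Y := biUnion_subset.2 fun x _ v hv => (mem_nbrs.1 hv).1
  have hAB : ∀ a ∈ A, ∀ b, G.Adj a b → b ∈ B := fun a ha b hab =>
    mem_biUnion.2 ⟨a, ha, mem_nbrs.2 ⟨hG.mem_right hab (hA ha), hab⟩⟩
  have hcB := card_sdiff_add_card_eq_card hBY
  obtain ⟨f, hfi, hf⟩ := exists_matching_of_hall (G := G) (S := X \ A) (B := Y \ B) fun T hT => by
    have h1 := hAmax (A ∪ T) (mem_powerset.2 (union_subset hA (hT.trans sdiff_subset)))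
    have h2 : #(A ∪ T) = #A + #T := card_union_of_disjoint (disjoint_sdiff.mono_right hT)
    have h3 : Y \ B ⊆ (Y \ (A ∪ T).biUnion (nbrs G Y)) ∪ T.biUnion (nbrs G (Y \ B)) := by
      intro v hv
      rw [mem_union, or_iff_not_imp_right]
      intro hv'
      refine mem_sdiff.2 ⟨(mem_sdiff.1 hv).1, fun h => ?_⟩
      obtain ⟨a, ha, hav⟩ := mem_biUnion.1 h
      have hav := (mem_nbrs.1 hav).2
      rcases mem_union.1 ha with ha | ha
      · exact (mem_sdiff.1 hv).2 (hAB a ha v hav)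
      · exact hv' (mem_biUnion.2 ⟨a, ha, mem_nbrs.2 ⟨hv, hav⟩⟩)
    have h4 := (card_le_card h3).trans (card_union_le _ _)
    omega
  obtain ⟨g, hgi, hg⟩ := exists_matching_of_hall (G := G) (S := B) (B := A) fun T hT => by
    have h1 := hAmax (A \ T.biUnion (nbrs G A)) (mem_powerset.2 (sdiff_subset.trans hA))
    have h2 : T.biUnion (nbrs G A) ⊆ A := biUnion_subset.2 fun x _ v hv => (mem_nbrs.1 hv).1
    have h3 := card_sdiff_add_card_eq_card h2
    have h4 : (Y \ B) ∪ T ⊆ Y \ (A \ T.biUnion (nbrs G A)).biUnion (nbrs G Y) := by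
      intro v hv
      simp only [mem_union, mem_sdiff, mem_biUnion, mem_nbrs, not_exists, not_and] at hv ⊢
      rcases hv with hv | hv
      · exact ⟨hv.1, fun a ha _ hav => hv.2 (hAB a ha.1 v hav)⟩
      · exact ⟨hBY (hT hv), fun a ha _ hav => ha.2 v hv ha.1 hav.symm⟩
    have h5 := card_le_card h4
    rw [card_union_of_disjoint (disjoint_sdiff.symm.mono_right hT)] at h5
    omega
  have hBA : ∀ v ∈ Y \ B, ∀ u, G.Adj v u → u ∈ X \ A := fun v hv u hvu =>
    mem_sdiff.2 ⟨hG.mem_left hvu (mem_sdiff.1 hv).1, fun hu => (mem_sdiff.1 hv).2 (hAB u hu v hvu.symm)⟩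
  let mt : V → V → Prop := fun u w => (u ∈ X \ A ∧ w = f u) ∨ (w ∈ B ∧ u = g w)
  have hmt : ∀ u w, mt u w → u ∈ (X : Set V) ∧ w ∈ (Y : Set V) ∧ G.Adj u w := by
    rintro u w (⟨hu, rfl⟩ | ⟨hw, rfl⟩)
    · exact ⟨(mem_sdiff.1 hu).1, (mem_sdiff.1 (hf u hu).1).1, (hf u hu).2⟩
    · exact ⟨hA (hg w hw).1, hBY hw, (hg w hw).2.symm⟩
  have hmtl : ∀ u u' w, mt u w → mt u' w → u = u' := by
    rintro u u' w (⟨hu, rfl⟩ | ⟨hw, rfl⟩) (⟨hu', h⟩ | ⟨hw', h⟩)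
    · exact hfi hu hu' h
    · exact absurd hw' (mem_sdiff.1 (hf u hu).1).2
    · rw [h] at hw
      exact absurd hw (mem_sdiff.1 (hf u' hu').1).2
    · exact h.symm
  have hmtr : ∀ u w w', mt u w → mt u w' → w = w' := by
    rintro u w w' (⟨hu, rfl⟩ | ⟨hw, rfl⟩) (⟨hu', h⟩ | ⟨hw', h⟩)
    · exact h.symm
    · rw [h] at hu
      exact absurd (hg w' hw').1 (mem_sdiff.1 hu).2
    · exact absurd (hg w hw).1 (mem_sdiff.1 hu').2
    · exact hgi hw hw' h
  have hA0 : A.Nonempty := by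
    rw [← card_pos]
    omega
  have hB0 : (Y \ B).Nonempty := by
    rw [← card_pos]
    have := card_le_card hA
    omega
  obtain ⟨w, hw, v, hv, hwv⟩ : ∃ w ∈ B, ∃ v ∈ X \ A, G.Adj w v := by
    by_contra! hcon
    obtain ⟨b, hb⟩ := hB0
    obtain ⟨a, ha⟩ := hA0
    obtain ⟨u, hu⟩ := card_pos.1 (hdY b (mem_sdiff.1 hb).1)
    have hbu := (mem_nbrs.1 hu).2
    have hbA : b ∉ A := fun h => hXY (hA h) (mem_sdiff.1 hb).1
    have := hS.mem_of_closed b (A ∪ B : Set V) ?_ ⟨a, .inl ha⟩ ?_ ?_ u (hS.mem_of_adj hbu) hbu.ne'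
    · rcases this with h | h
      · exact (mem_sdiff.1 (hBA b hb u hbu)).2 h
      · exact hXY (mem_sdiff.1 (hBA b hb u hbu)).1 (hBY h)
    · exact Set.union_subset_union (by exact_mod_cast hA) (by exact_mod_cast hBY)
    · rintro (h | h)
      · exact hbA h
      · exact (mem_sdiff.1 hb).2 h
    · rintro c (h | h) d hcd
      · exact .inr (.inr (hAB c h d hcd))
      · right; left
        by_contra hd
        exact hcon c h d (mem_sdiff.2 ⟨hG.mem_left hcd (hBY h), hd⟩) hcd
  have hinit : ∃ x y P, MatchedPath G X A (Y \ B : Finset V) mt True x y P := by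
    have m1 : mt (g w) w := .inr ⟨hw, rfl⟩
    have m2 : mt v (f v) := .inl ⟨hv, rfl⟩
    have h1 := hmt _ _ m1
    have h2 := hmt _ _ m2
    have hgv : g w ≠ v := fun h => (mem_sdiff.1 hv).2 (h ▸ (hg w hw).1)
    have hwf : w ≠ f v := fun h => (mem_sdiff.1 (hf v hv).1).2 (h ▸ hw)
    have hgf : g w ≠ f v := fun h => hXY h1.1 (h ▸ h2.2.1)
    refine ⟨g w, f v, [g w, w, v, f v], ⟨?_, ?_, rfl, rfl⟩, (hg w hw).1, (hf v hv).1, ?_, ?_⟩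
    · simp [h1.2.2, h2.2.2, hwv]
    · simp [h1.2.2.ne, h2.2.2.ne, hwv.ne, hgv, hwf, hgf]
    · intro a b hab
      simpa using closed_insert (p := fun a => a = v ∨ a = f v ∨ False) hXY hmt hmtl hmtr m1
        (closed_insert hXY hmt hmtl hmtr m2 (by simp)) a b hab
    · simp only [List.isChain_cons_cons, List.IsChain.singleton, and_true]
      exact ⟨fun _ _ => m1, fun _ h => absurd (hBY hw) (hXY h), fun _ _ => m2⟩
  obtain ⟨x, y, P, hP, -, hxP, hyP⟩ := exists_maximal_matchedPath hG hmt hmtl hmtr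
    (fun x hx w hw => ⟨g w, (hg w (hAB x hx w hw)).1, .inr ⟨hAB x hx w hw, rfl⟩⟩)
    (fun y hy u hu => ⟨f u, (hf u (hBA y hy u hu)).1, .inl ⟨hBA y hy u hu, rfl⟩⟩)
    (by exact_mod_cast sdiff_subset) hinit
  have hxA : x ∈ A := hP.head_mem
  have hyB : y ∈ Y \ B := hP.last_mem
  have hxX : x ∈ X := hA hxA
  have hyY : y ∈ Y := (mem_sdiff.1 hyB).1
  rcases hP.path.hasLongCycle_or hG hS (Nx := nbrs G Y x) (Ny := nbrs G X y) hxX hyY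
    (fun u => by simpa using fun h => hG.mem_right h hxX)
    (fun u => by simpa using fun h => hG.mem_left h hyY)
    (card_pos.1 (hdX x hxX)) (card_pos.1 (hdY y hyY))
    (fun u hu => hxP u (mem_nbrs.1 hu).2) (fun u hu => hyP u (mem_nbrs.1 hu).2) with
    h | ⟨k₁, u, v, k₂, hk, hyu, hxv⟩
  · obtain ⟨a, b, l, h1, h2, h3⟩ := h
    have := hd x hxX y hyY
    exact ⟨a, b, l, h1, h2, by omega⟩
  · exfalso
    have hm := hP.matched
    rw [hk] at hm
    have h1 := (List.isChain_cons_cons.1 (hm.infix (l₁ := u :: v :: k₂) ⟨k₁, [], by simp⟩)).1 trivial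
      (hG.mem_left hyu hyY)
    rcases h1 with ⟨hu, rfl⟩ | ⟨hv, rfl⟩
    · exact (mem_sdiff.1 (hf u hu).1).2 (hAB x hxA _ hxv)
    · exact (mem_sdiff.1 hyB).2 (hAB _ (hg v hv).1 y hyu.symm)

/-- If more vertices of `Y` than `#X₀` have `t` neighbours in `X₀`, an alternating path closes up to a
long cycle. -/
theorem hasLongCycle_of_card_lt [Finite V] {X Y : Finset V} (hG : G.IsBipartiteWith (X : Set V) Y)
    {t : ℕ} (ht : 2 ≤ t) {X₀ Y₀ : Finset V} (hX₀ : X₀ ⊆ X) (hY₀ : Y₀ ⊆ Y) (hlt : #X₀ < #Y₀)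
    (hd : ∀ y ∈ Y₀, t ≤ #(nbrs G X₀ y)) : HasLongCycle G (2 * t) := by
  classical
  have hXY := Set.disjoint_left.1 hG.disjoint
  obtain ⟨T, hT, hTmin⟩ := exists_min_image
    (Y₀.powerset.filter fun T => #(T.biUnion (nbrs G X₀)) < #T) card
    ⟨Y₀, by
      simp only [mem_filter, mem_powerset, subset_refl, true_and]
      exact (card_le_card (biUnion_subset.2 fun x _ v hv => (mem_nbrs.1 hv).1)).trans_lt hlt⟩
  simp only [mem_filter, mem_powerset, and_imp] at hT hTmin
  obtain ⟨hTY, hTlt⟩ := hT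
  obtain ⟨y₀, hy₀⟩ : T.Nonempty := card_pos.1 (by omega)
  obtain ⟨f, hfi, hf⟩ := exists_matching_of_hall (G := G) (S := T.erase y₀) (B := X₀)
    fun T' hT' => by
      by_contra! h
      have h1 := hTmin T' (hT'.trans ((erase_subset _ _).trans hTY)) h
      have h2 := card_le_card hT'
      have h3 := card_erase_lt_of_mem hy₀
      omega
  have himg : (T.erase y₀).image f = T.biUnion (nbrs G X₀) := by
    refine eq_of_subset_of_card_le (image_subset_iff.2 fun y hy => mem_biUnion.2
      ⟨y, mem_of_mem_erase hy, mem_nbrs.2 (hf y hy)⟩) ?_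
    rw [card_image_of_injOn hfi, card_erase_of_mem hy₀]
    omega
  let C : V → List V → Prop := fun y P => IsPathList G y y₀ P ∧ y ∈ T ∧
    ∀ z ∈ T.erase y₀, (z ∈ P ↔ f z ∈ P)
  have := Fintype.ofFinite V
  obtain ⟨y, P, ⟨hP, hyT, hPf⟩, hmax⟩ : ∃ y P, C y P ∧ ∀ y' P', C y' P' → P'.length ≤ P.length := by
    have hfin : {n | ∃ y P, C y P ∧ P.length = n}.Finite :=
      (Set.finite_Iic (Fintype.card V)).subset (by
        rintro _ ⟨y, P, hP, rfl⟩
        exact hP.1.nodup.length_le_card)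
    obtain ⟨n, ⟨⟨y, P, hP, rfl⟩, hmax⟩⟩ := hfin.exists_maximal ⟨1, y₀, [y₀], ⟨.single G y₀, hy₀, by
      intro z hz
      have h1 := hf z hz
      have h2 : f z ≠ y₀ := by
        rintro h
        exact hXY (hX₀ h1.1) (h ▸ hY₀ (hTY hy₀))
      simp [h2, ne_of_mem_erase hz]⟩, rfl⟩
    refine ⟨y, P, hP, fun y' P' hP' => ?_⟩
    rcases le_total P'.length P.length with h | h
    · exact h
    · exact hmax ⟨y', P', hP', rfl⟩ h
  have hyX : ∀ x ∈ nbrs G X₀ y, x ∈ P := by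
    intro x hx
    by_contra hxP
    have hxN : x ∈ (T.erase y₀).image f := himg ▸ mem_biUnion.2 ⟨y, hyT, hx⟩
    obtain ⟨z, hz, rfl⟩ := mem_image.1 hxN
    have hzP : z ∉ P := fun h => hxP ((hPf z hz).1 h)
    have hzf := (hf z hz).2
    have h1 := (hP.cons (mem_nbrs.1 hx).2.symm hxP).cons hzf (by simp [hzf.ne, hzP])
    have h2 := hmax z _ ⟨h1, mem_of_mem_erase hz, fun w hw => ?_⟩
    · simp at h2
    · have h3 := hPf w hw
      have h4 : f w = f z ↔ w = z := ⟨fun h => hfi hw hz h, fun h => h ▸ rfl⟩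
      have h5 : w ≠ f z := by
        rintro rfl
        exact hXY (hX₀ (hf z hz).1) (hY₀ (hTY (mem_of_mem_erase hw)))
      have h6 : f w ≠ z := by
        intro h
        exact hXY (hX₀ (hf w hw).1) (h ▸ hY₀ (hTY (mem_of_mem_erase hz)))
      simp only [List.mem_cons, h4, h5, h6, h3, false_or]
  have hdy := hd y (hTY hyT)
  obtain ⟨x, hx⟩ : (nbrs G X₀ y).Nonempty := card_pos.1 (by omega)
  obtain ⟨l₁, a, l₂, rfl, ha, hl₂⟩ := List.exists_split_last ⟨x, hyX x hx, hx⟩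
  have hya := (mem_nbrs.1 ha).2
  have hQ := hP.init
  have hNQ : ∀ v ∈ nbrs G X₀ y, v ∈ l₁ ++ [a] := by
    intro v hv
    have h1 := hyX v hv
    have h2 := hl₂ v
    simp only [List.mem_append, List.mem_cons, List.not_mem_nil, or_false] at h1 ⊢
    tauto
  refine ⟨y, a, _, hQ, hya.symm, ?_⟩
  obtain ⟨m, hm⟩ := hQ.exists_cons
  rw [hm] at hQ hNQ ⊢
  cases m with
  | nil => exact absurd (by simpa using hQ.last) hya.ne
  | cons c m =>
    have hQ' : IsPathList G c a (c :: m) := IsPathList.tail (l := [y]) hQ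
    have := hQ'.two_mul_card_le hG (N := nbrs G X₀ y) (fun v hv =>
      (List.mem_cons.1 (hNQ v hv)).resolve_left (mem_nbrs.1 hv).2.ne') fun u hu v hv huv =>
        hXY (hX₀ (mem_nbrs.1 hv).1) (hG.mem_right huv (hX₀ (mem_nbrs.1 hu).1))
    simp only [List.length_cons] at this ⊢
    omega

/-- The number of pairs in `A × B` that are adjacent in `G`. -/
noncomputable def edgeCount (G : SimpleGraph V) (A B : Finset V) : ℕ := ∑ x ∈ A, #(nbrs G B x)

theorem edgeCount_comm (A B : Finset V) : edgeCount G A B = edgeCount G B A := by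
  classical
  have := sum_card_bipartiteAbove_eq_sum_card_bipartiteBelow (s := A) (t := B) G.Adj
  unfold edgeCount
  convert this using 2
  · congr 1
  · congr 1
    ext
    simp [mem_bipartiteBelow, G.adj_comm]

theorem edgeCount_eq_add_sdiff [DecidableEq V] {S A : Finset V} (h : S ⊆ A) (B : Finset V) :
    edgeCount G A B = edgeCount G S B + edgeCount G (A \ S) B := by
  rw [add_comm]
  exact (sum_sdiff h).symm

theorem edgeCount_eq_add_sdiff_right [DecidableEq V] {T B : Finset V} (h : T ⊆ B) (A : Finset V) :
    edgeCount G A B = edgeCount G A T + edgeCount G A (B \ T) := by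
  rw [edgeCount_comm, edgeCount_eq_add_sdiff h, edgeCount_comm T, edgeCount_comm (B \ T)]

theorem edgeCount_le {A B C : Finset V} (h : ∀ x ∈ A, nbrs G B x ⊆ C) :
    edgeCount G A B ≤ #A * #C := by
  rw [← smul_eq_mul]
  exact sum_le_card_nsmul _ _ _ fun x hx => card_le_card (h x hx)

/-- Deleting `i < t` vertices from each side of `(X, Y)` destroys more than `i * t` edges. -/
def Expanding [DecidableEq V] (G : SimpleGraph V) (X Y : Finset V) (t : ℕ) : Prop :=
  ∀ S ⊆ X, ∀ T ⊆ Y, #S = #T → 1 ≤ #S → #S < t →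
    #S * t + 1 ≤ edgeCount G S Y + edgeCount G T (X \ S)

section

variable [DecidableEq V] {X Y : Finset V} {t : ℕ}

theorem Expanding.symm (h : Expanding G X Y t) : Expanding G Y X t := by
  intro T hT S hS hTS h1 h2
  have h3 := h S hS T hT hTS.symm (hTS ▸ h1) (hTS ▸ h2)
  have h4 := edgeCount_eq_add_sdiff_right (G := G) hS T
  have h5 := edgeCount_eq_add_sdiff_right (G := G) hT S
  have h6 := edgeCount_comm (G := G) S T
  rw [hTS]
  omega

theorem Expanding.le_card_nbrs_add (h : Expanding G X Y t) (ht : 2 ≤ t) {x y : V} (hx : x ∈ X)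
    (hy : y ∈ Y) : t + 1 ≤ #(nbrs G Y x) + #(nbrs G (X.erase x) y) := by
  have := h {x} (by simpa using hx) {y} (by simpa using hy) rfl le_rfl (by rwa [card_singleton])
  simpa [edgeCount, sdiff_singleton_eq_erase] using this

theorem Expanding.two_le_card_nbrs [Finite V] (h : Expanding G X Y t)
    (hG : G.IsBipartiteWith (X : Set V) Y) (ht : 2 ≤ t) (hXY : #X ≤ #Y)
    (hC : ¬ HasLongCycle G (2 * t)) {x : V} (hx : x ∈ X) : 2 ≤ #(nbrs G Y x) := by
  by_contra! hd
  refine hC (hasLongCycle_of_card_lt hG ht (erase_subset x X) subset_rfl ?_ fun y hy => ?_)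
  · exact (card_erase_lt_of_mem hx).trans_le hXY
  · have := h.le_card_nbrs_add ht hx hy
    omega

theorem Expanding.le_card_of_closed (h : Expanding G X Y t) (hdX : ∀ x ∈ X, 2 ≤ #(nbrs G Y x))
    (hdY : ∀ y ∈ Y, 2 ≤ #(nbrs G X y)) {S T : Finset V} (hS : S ⊆ X) (hT : T ⊆ Y) {v : V}
    (hSv : ∀ x ∈ S, nbrs G Y x ⊆ insert v T) (hTS : ∀ y ∈ T, nbrs G X y ⊆ S)
    (hne : (S ∪ T).Nonempty) : t ≤ #S ∨ t ≤ #T := by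
  by_contra! hlt
  have hins : #(insert v T) ≤ #T + 1 := card_insert_le _ _
  have hT0 : T.Nonempty := by
    by_contra hT0
    rw [not_nonempty_iff_eq_empty] at hT0
    subst hT0
    obtain ⟨x, hx⟩ := hne
    rw [union_empty] at hx
    have h1 := card_le_card (hSv x hx)
    have h2 := hdX x (hS hx)
    simp at h1
    omega
  have hS0 : S.Nonempty := by
    obtain ⟨y, hy⟩ := hT0
    have h2 := hdY y (hT hy)
    exact (card_pos.1 (by omega : 0 < #(nbrs G X y))).mono (hTS y hy)
  rw [← card_pos] at hT0 hS0
  rcases le_total #T #S with hle | hle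
  · obtain ⟨S', hS', hcard⟩ := exists_subset_card_eq hle
    have h1 := h S' (hS'.trans hS) T hT hcard (by omega) (by omega)
    have h2 : edgeCount G S' Y ≤ #S' * #(insert v T) := edgeCount_le fun x hx => hSv x (hS' hx)
    have h3 : edgeCount G T (X \ S') ≤ #T * #(S \ S') := edgeCount_le fun y hy u hu => by
      rw [mem_nbrs, mem_sdiff] at hu
      exact mem_sdiff.2 ⟨hTS y hy (mem_nbrs.2 ⟨hu.1.1, hu.2⟩), hu.1.2⟩
    rw [card_sdiff_of_subset hS', hcard] at h3
    rw [hcard] at h1 h2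
    obtain ⟨d, hd⟩ := Nat.exists_eq_add_of_le hle
    rw [hd, Nat.add_sub_cancel_left] at h3
    nlinarith
  · obtain ⟨T', hT', hcard⟩ := exists_subset_card_eq hle
    have h1 := h S hS T' (hT'.trans hT) hcard.symm (by omega) (by omega)
    have h2 : edgeCount G S Y ≤ #S * #(insert v T) := edgeCount_le hSv
    have h3 : edgeCount G T' (X \ S) ≤ #T' * #(∅ : Finset V) := edgeCount_le fun y hy u hu => by
      rw [mem_nbrs, mem_sdiff] at hu
      exact absurd (hTS y (hT' hy) (mem_nbrs.2 ⟨hu.1.1, hu.2⟩)) hu.1.2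
    rw [card_empty] at h3
    nlinarith

theorem cut_bound_lt {a₁ a₂ b₁ b₂ n t e : ℕ} (ha : a₁ + a₂ = n) (hb : b₁ + b₂ + 1 = n)
    (htn : t ≤ n) (hnt : n + 2 ≤ 2 * t) (ha₁ : t ≤ a₁) (hb₂ : t ≤ b₂)
    (he : e ≤ a₁ * (b₁ + 1) + a₂ * (b₂ + 1)) : e + t < n * t + 2 := by
  obtain ⟨k, rfl⟩ := Nat.exists_eq_add_of_le htn
  have hp : a₂ ≤ k := by omega
  have hq : b₁ + 1 ≤ k := by omega
  obtain rfl : a₁ = t + k - a₂ := by omega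
  obtain rfl : b₂ = t + k - (b₁ + 1) := by omega
  have h1 : 0 ≤ ((k : ℤ) - a₂) * (t + k - 2 * (b₁ + 1) + 1) := mul_nonneg (by omega) (by omega)
  have h2 : 0 ≤ ((k : ℤ) - (b₁ + 1)) * (t - k) := mul_nonneg (by omega) (by omega)
  have h3 : 0 ≤ (t : ℤ) * (t - k - 2) := mul_nonneg (by omega) (by omega)
  zify [show a₂ ≤ t + k by omega, show b₁ + 1 ≤ t + k by omega] at he ⊢
  nlinarith

theorem Expanding.mem_of_closed (h : Expanding G X Y t) (hG : G.IsBipartiteWith (X : Set V) Y)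
    (hdX : ∀ x ∈ X, 2 ≤ #(nbrs G Y x)) (hdY : ∀ y ∈ Y, 2 ≤ #(nbrs G X y)) {n : ℕ} (hX : #X = n)
    (hY : #Y = n) (htn : t ≤ n) (hnt : n + 2 ≤ 2 * t) (he : n * t + 2 ≤ edgeCount G X Y + t)
    {v : V} (hv : v ∈ Y) {D : Set V} (hDS : D ⊆ (X ∪ Y : Set V)) (hD0 : D.Nonempty) (hvD : v ∉ D)
    (hD : ∀ a ∈ D, ∀ b, G.Adj a b → b = v ∨ b ∈ D) {u : V} (hu : u ∈ (X ∪ Y : Set V))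
    (huv : u ≠ v) : u ∈ D := by
  classical
  by_contra huD
  have hXY := Set.disjoint_left.1 hG.disjoint
  have hvX : v ∉ X := fun h => hXY h hv
  set S₁ := X.filter (· ∈ D)
  set S₂ := X.filter (· ∉ D)
  set T₁ := Y.filter (· ∈ D)
  set T₂ := (Y.erase v).filter (· ∉ D)
  have hS : #S₁ + #S₂ = n := by rw [← hX]; exact card_filter_add_card_filter_not _
  have hT : #T₁ + #T₂ + 1 = n := by
    have h1 : (Y.erase v).filter (· ∈ D) = T₁ := by
      ext w
      simp only [T₁, mem_filter, mem_erase]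
      refine ⟨fun h => ⟨h.1.2, h.2⟩, fun h => ⟨⟨?_, h.1⟩, h.2⟩⟩
      rintro rfl
      exact hvD h.2
    rw [← h1, card_filter_add_card_filter_not, card_erase_add_one hv, hY]
  have n1 : ∀ x ∈ S₁, nbrs G Y x ⊆ insert v T₁ := fun x hx b hb => by
    rw [mem_nbrs] at hb
    rw [mem_filter] at hx
    rw [mem_insert, mem_filter]
    exact (hD x hx.2 b hb.2).imp_right fun h => ⟨hb.1, h⟩
  have n2 : ∀ y ∈ T₁, nbrs G X y ⊆ S₁ := fun y hy b hb => by
    rw [mem_nbrs] at hb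
    rw [mem_filter] at hy
    rw [mem_filter]
    refine ⟨hb.1, (hD y hy.2 b hb.2).resolve_left ?_⟩
    rintro rfl
    exact hvX hb.1
  have n3 : ∀ x ∈ S₂, nbrs G Y x ⊆ insert v T₂ := fun x hx b hb => by
    rw [mem_nbrs] at hb
    rw [mem_filter] at hx
    rw [mem_insert, mem_filter, mem_erase]
    refine or_iff_not_imp_left.2 fun hbv => ⟨⟨hbv, hb.1⟩, fun hbD => ?_⟩
    rcases hD b hbD x hb.2.symm with rfl | h
    · exact hvX hx.1
    · exact hx.2 h
  have n4 : ∀ y ∈ T₂, nbrs G X y ⊆ S₂ := fun y hy b hb => by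
    rw [mem_nbrs] at hb
    rw [mem_filter, mem_erase] at hy
    rw [mem_filter]
    refine ⟨hb.1, fun hbD => ?_⟩
    rcases hD b hbD y hb.2.symm with rfl | h
    · exact hy.1.1 rfl
    · exact hy.2 h
  have p1 : t ≤ #S₁ ∨ t ≤ #T₁ := h.le_card_of_closed hdX hdY (filter_subset _ _) (filter_subset _ _) n1 n2 (by
    obtain ⟨w, hw⟩ := hD0
    refine ⟨w, ?_⟩
    rw [mem_union, mem_filter, mem_filter]
    exact (hDS hw).imp (fun h => ⟨h, hw⟩) fun h => ⟨h, hw⟩)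
  have p2 : t ≤ #S₂ ∨ t ≤ #T₂ := h.le_card_of_closed hdX hdY (filter_subset _ _)
    ((filter_subset _ _).trans (erase_subset _ _)) n3 n4 (by
      refine ⟨u, ?_⟩
      rw [mem_union, mem_filter, mem_filter, mem_erase]
      exact hu.imp (fun h => ⟨h, huD⟩) fun h => ⟨⟨huv, h⟩, huD⟩)
  have e0 : edgeCount G X Y = edgeCount G S₁ Y + edgeCount G S₂ Y := by
    rw [edgeCount_eq_add_sdiff (filter_subset (· ∈ D) X), ← filter_not]
  have e1 := (edgeCount_le n1).trans (Nat.mul_le_mul_left _ (card_insert_le _ _))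
  have e2 := (edgeCount_le n3).trans (Nat.mul_le_mul_left _ (card_insert_le _ _))
  rcases p1 with p1 | p1 <;> rcases p2 with p2 | p2
  · omega
  · exact he.not_gt <| cut_bound_lt hS hT htn hnt p1 p2 (e0.trans_le (add_le_add e1 e2))
  · exact he.not_gt <| cut_bound_lt ((add_comm _ _).trans hS) (b₁ := #T₂) (b₂ := #T₁) (by omega)
      htn hnt p2 p1 (e0.trans_le ((add_le_add e1 e2).trans_eq (add_comm _ _)))
  · omega

theorem Expanding.noCutVertex (h : Expanding G X Y t) (hG : G.IsBipartiteWith (X : Set V) Y)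
    (hdX : ∀ x ∈ X, 2 ≤ #(nbrs G Y x)) (hdY : ∀ y ∈ Y, 2 ≤ #(nbrs G X y)) {n : ℕ} (hX : #X = n)
    (hY : #Y = n) (htn : t ≤ n) (hnt : n + 2 ≤ 2 * t) (he : n * t + 2 ≤ edgeCount G X Y + t) :
    NoCutVertex G (X ∪ Y : Set V) := by
  have key : ∀ v ∈ (X ∪ Y : Set V), ∀ D : Set V, D ⊆ (X ∪ Y : Set V) → D.Nonempty → v ∉ D →
      (∀ a ∈ D, ∀ b, G.Adj a b → b = v ∨ b ∈ D) → ∀ u ∈ (X ∪ Y : Set V), u ≠ v → u ∈ D := by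
    rintro v (hv | hv) D hDS hD0 hvD hD u hu huv
    · exact h.symm.mem_of_closed hG.symm hdY hdX hY hX htn hnt (edgeCount_comm (G := G) X Y ▸ he) hv
        (Set.union_comm _ _ ▸ hDS) hD0 hvD hD (Set.union_comm _ _ ▸ hu) huv
    · exact h.mem_of_closed hG hdX hdY hX hY htn hnt he hv hDS hD0 hvD hD hu huv
  refine ⟨fun a b hab => ?_, fun v D hDS hD0 hvD hD u hu huv => ?_⟩
  · rcases hG.mem_of_adj hab with h | h
    · exact .inr h.2
    · exact .inl h.2
  by_cases hv : v ∈ (X ∪ Y : Set V)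
  · exact key v hv D hDS hD0 hvD hD u hu huv
  have hD' : ∀ a ∈ D, ∀ b, G.Adj a b → b ∈ D := fun a ha b hab =>
    (hD a ha b hab).resolve_left fun hb => hv <| hb ▸ by
      rcases hG.mem_of_adj hab with h | h
      · exact .inr h.2
      · exact .inl h.2
  by_contra huD
  obtain ⟨w, hw, huw⟩ : ∃ w ∈ (X ∪ Y : Set V), G.Adj u w := by
    rcases hu with hu | hu
    · obtain ⟨w, hw⟩ := card_pos.1 (by have := hdX u hu; omega : 0 < #(nbrs G Y u))
      exact ⟨w, .inr (mem_nbrs.1 hw).1, (mem_nbrs.1 hw).2⟩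
    · obtain ⟨w, hw⟩ := card_pos.1 (by have := hdY u hu; omega : 0 < #(nbrs G X u))
      exact ⟨w, .inl (mem_nbrs.1 hw).1, (mem_nbrs.1 hw).2⟩
  exact huD (hD' w (key u hu D hDS hD0 huD (fun a ha b hab => .inr (hD' a ha b hab)) w hw huw.ne') u
    huw.symm)

theorem Expanding.hasLongCycle [Finite V] (h : Expanding G X Y t)
    (hG : G.IsBipartiteWith (X : Set V) Y) {n : ℕ} (hX : #X = n) (hY : #Y = n) (htn : t ≤ n)
    (hnt : n + 2 ≤ 2 * t) (he : n * t + 2 ≤ edgeCount G X Y + t) : HasLongCycle G (2 * t) := by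
  by_contra hC
  have ht : 2 ≤ t := by omega
  have hdX : ∀ x ∈ X, 2 ≤ #(nbrs G Y x) := fun x hx =>
    h.two_le_card_nbrs hG ht (by omega) hC hx
  have hdY : ∀ y ∈ Y, 2 ≤ #(nbrs G X y) := fun y hy =>
    h.symm.two_le_card_nbrs hG.symm ht (by omega) hC hy
  refine hC (hasLongCycle_of_degrees hG (h.noCutVertex hG hdX hdY hX hY htn hnt he)
    (hX.trans hY.symm) (card_pos.1 (by omega)) (hX ▸ htn) (fun x hx => one_le_two.trans (hdX x hx))
    (fun y hy => one_le_two.trans (hdY y hy)) fun x hx y hy =>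
      (h.le_card_nbrs_add ht hx hy).trans (Nat.add_le_add_left (card_le_card fun v hv => ?_) _))
  rw [mem_nbrs] at hv ⊢
  exact ⟨mem_of_mem_erase hv.1, hv.2⟩

end

theorem hasLongCycle_of_edgeCount [Finite V] {t n : ℕ} {X Y : Finset V}
    (hG : G.IsBipartiteWith (X : Set V) Y) (hX : #X = n) (hY : #Y = n) (htn : t ≤ n)
    (hnt : n + 2 ≤ 2 * t) (he : n * t + 2 ≤ edgeCount G X Y + t) : HasLongCycle G (2 * t) := by
  classical
  induction n using Nat.strong_induction_on generalizing G X Y with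
  | _ n ih =>
    by_contra hC
    refine hC (Expanding.hasLongCycle (fun S hS T hT hST h1 h2 => ?_) hG hX hY htn hnt he)
    by_contra! hlt
    have e1 := edgeCount_eq_add_sdiff (G := G) hS Y
    have e2 := edgeCount_eq_add_sdiff_right (G := G) hT (X \ S)
    rw [edgeCount_comm (X \ S) T] at e2
    have cX : #(X \ S) + #S = n := by rw [card_sdiff_add_card_eq_card hS, hX]
    have cY : #(Y \ T) + #S = n := by rw [hST, card_sdiff_add_card_eq_card hT, hY]
    have hE : #(X \ S) * t + 2 ≤ edgeCount G (X \ S) (Y \ T) + t := by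
      rw [← cX] at he
      nlinarith
    by_cases hm : t ≤ #(X \ S)
    · refine hC (HasLongCycle.mono (SimpleGraph.between_le (s := (X \ S : Finset V))
        (t := (Y \ T : Finset V))) (ih #(X \ S) (by omega) (SimpleGraph.between_isBipartiteWith ?_)
          rfl (by omega) hm (by omega) ?_))
      · rw [disjoint_coe]
        exact (disjoint_coe.1 hG.disjoint).mono sdiff_subset sdiff_subset
      · refine hE.trans (Nat.add_le_add_right (sum_le_sum fun x hx => card_le_card fun y hy => ?_) _)
        rw [mem_nbrs] at hy ⊢
        exact ⟨hy.1, hy.2, .inl ⟨hx, hy.1⟩⟩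
    · have h3 : edgeCount G (X \ S) (Y \ T) ≤ #(X \ S) * #(Y \ T) :=
        edgeCount_le fun x _ y hy => (mem_nbrs.1 hy).1
      rw [show #(Y \ T) = #(X \ S) by omega] at h3
      obtain ⟨d, hd⟩ := Nat.exists_eq_add_of_lt (not_le.1 hm)
      obtain ⟨j, hj⟩ := Nat.exists_eq_add_of_le (show 1 ≤ #(X \ S) by omega)
      rw [hd, hj] at hE
      rw [hj] at h3
      nlinarith

theorem edgeSet_ncard_le [Fintype V] {X Y : Finset V} (hG : G.IsBipartiteWith (X : Set V) Y) :
    G.edgeSet.ncard ≤ edgeCount G X Y := by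
  classical
  have : edgeCount G X Y = #(X.sigma fun x => nbrs G Y x) := (card_sigma _ _).symm
  rw [this, ← Set.ncard_coe_finset]
  refine (Set.ncard_le_ncard (t := (fun p : (_ : V) × V => s(p.1, p.2)) ''
    (X.sigma fun x => nbrs G Y x : Finset _)) ?_ (Set.toFinite _)).trans
    (Set.ncard_image_le (Set.toFinite _))
  intro e he
  induction e with
  | _ a b =>
    rw [SimpleGraph.mem_edgeSet] at he
    rcases hG.mem_of_adj he with h | h
    · exact ⟨⟨a, b⟩, by simpa [he] using h, rfl⟩
    · exact ⟨⟨b, a⟩, by simpa [he.symm] using h.symm, Sym2.eq_swap⟩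

end BipartiteCircumference

/-- **Theorem (Li–Ning, balanced case, part (i)).** Let `G` be a balanced bipartite graph of
order `2n` with `n ≥ 2k+2`. If `e(G) ≥ (n-k-1)n + k + 2`, then the circumference of `G`
satisfies `c(G) ≥ 2n - 2k`, i.e. `G` has a cycle of length at least `2n - 2k`. -/
theorem stmt_4 {V : Type} [Fintype V] [DecidableEq V]
    (G : SimpleGraph V) (X Y : Finset V) (n k : ℕ)
    (hpart : ∀ v : V, v ∈ X ∨ v ∈ Y) (hdisj : Disjoint X Y)
    (hbip : ∀ u v : V, G.Adj u v → (u ∈ X ∧ v ∈ Y) ∨ (u ∈ Y ∧ v ∈ X))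
    (hX : X.card = n) (hY : Y.card = n)
    (hnk : 2 * k + 2 ≤ n)
    (he : (n - k - 1) * n + k + 2 ≤ G.edgeSet.ncard) :
    ∃ (v : V) (w : G.Walk v v), w.IsCycle ∧ 2 * n - 2 * k ≤ w.length := by
  have hG : G.IsBipartiteWith (X : Set V) Y := ⟨Finset.disjoint_coe.2 hdisj, fun u v h => hbip u v h⟩
  have hE := BipartiteCircumference.edgeSet_ncard_le hG
  obtain ⟨t, rfl⟩ := Nat.exists_eq_add_of_le (show k + 1 ≤ n by omega)
  rw [show k + 1 + t - k - 1 = t by omega] at he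
  obtain ⟨a, b, l, hl, hba, hlen⟩ := BipartiteCircumference.hasLongCycle_of_edgeCount (t := t + 1) hG
    hX hY (by omega) (by omega) (by nlinarith)
  obtain ⟨w, hw, hwl⟩ := hl.exists_isCycle hba (by omega)
  exact ⟨b, w, hw, by omega⟩
end
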